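/- arXiv:2506.17575 — 4 statements merged into one kernel-verified Lean document; each statement's English description precedes it below -/
import Mathlib

section
/- Let 1 < α < 2 and β > 0. Then there exists a constant C > 0 (depending only on α and β) such that for every x ≥ 0, |E_{α,β}(−x)| ≤ C / (1 + x). -/
/-- The two-parameter Mittag-Leffler function `E_{α,β}(t) = ∑_{k=0}^∞ t^k / Γ(α k + β)`
on the real line, with `Γ` the real Gamma function. -/
noncomputable def mittagLeffler (α β t : ℝ) : ℝ :=
  ∑' k : ℕ, t ^ k / Real.Gamma (α * k + β)

open Complex in
lemma ml_gamma_ratio (σ τ : ℝ) (hσ : 1 ≤ σ) :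
    Real.Gamma σ * ‖Complex.Gamma (1 + τ * I)‖ ≤ ‖Complex.Gamma (σ + τ * I)‖ := by
  have key : ∀ n : ℕ, n ≠ 0 → ‖Complex.GammaSeq (σ:ℂ) n‖ * ‖Complex.GammaSeq (1 + τ * I) n‖ ≤
      ‖Complex.GammaSeq 1 n‖ * ‖Complex.GammaSeq (σ + τ * I) n‖ := by
    intro n hn
    have hn' : 0 < n := Nat.pos_of_ne_zero hn
    simp only [Complex.GammaSeq, norm_div, norm_mul, norm_prod,
      Complex.norm_natCast_cpow_of_pos hn']
    simp only [ofReal_re, add_re, mul_re, I_re, ofReal_im, I_im, one_re]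
    norm_num only [mul_zero, zero_mul, sub_zero, mul_one, add_zero]
    rw [div_mul_div_comm, div_mul_div_comm, ← Finset.prod_mul_distrib, ← Finset.prod_mul_distrib]
    have e : (n:ℝ) ^ σ * ‖(n.factorial:ℂ)‖ * ((n:ℝ) ^ (1:ℝ) * ‖(n.factorial:ℂ)‖) =
      (n:ℝ) ^ (1:ℝ) * ‖(n.factorial:ℂ)‖ * ((n:ℝ) ^ σ * ‖(n.factorial:ℂ)‖) := by ring
    rw [e]
    apply div_le_div_of_nonneg_left (by positivity)
    · apply Finset.prod_pos
      intro j _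
      apply mul_pos
      · rw [norm_pos_iff]
        intro h
        have := congrArg Complex.re h
        simp at this
        have : (0:ℝ) ≤ j := by positivity
        linarith
      · rw [norm_pos_iff]
        intro h
        have := congrArg Complex.re h
        simp at this
        have : (0:ℝ) ≤ j := by positivity
        linarith
    · apply Finset.prod_le_prod
      · intros; positivity
      intro j _
      have hj : (0:ℝ) ≤ j := by positivity
      rw [← norm_mul, ← norm_mul]
      refine (pow_le_pow_iff_left₀ (norm_nonneg _) (norm_nonneg _) two_ne_zero).1 ?_
      rw [Complex.sq_norm, Complex.sq_norm, Complex.normSq_mul, Complex.normSq_mul]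
      simp [Complex.normSq_apply]
      have : (1 + (j:ℝ))^2 ≤ (σ + j)^2 := by gcongr
      nlinarith [mul_le_mul_of_nonneg_left this (sq_nonneg τ)]
  have t : ∀ s, Filter.Tendsto (fun n => ‖Complex.GammaSeq s n‖) Filter.atTop (nhds ‖Complex.Gamma s‖) :=
    fun s => (Complex.GammaSeq_tendsto_Gamma s).norm
  have := le_of_tendsto_of_tendsto ((t σ).mul (t (1 + τ * I))) ((t 1).mul (t (σ + τ * I)))
    ((Filter.eventually_ne_atTop 0).mono key)
  rw [Complex.Gamma_ofReal, Complex.norm_real, Complex.Gamma_one, norm_one, one_mul,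
    Real.norm_of_nonneg (Real.Gamma_pos_of_pos (by linarith)).le] at this
  exact this

open Complex in
lemma ml_gamma_one (τ : ℝ) :
    1 ≤ ‖Complex.Gamma (1 + τ * I)‖ * Real.exp (Real.pi / 2 * |τ|) := by
  rcases eq_or_ne τ 0 with rfl | hτ
  · simp
  have h1 : Complex.Gamma (1 + τ * I) * Complex.Gamma (1 - τ * I) =
      (τ * I) * (Real.pi / Complex.sin (Real.pi * (τ * I))) := by
    rw [← Complex.Gamma_mul_Gamma_one_sub, add_comm, Complex.Gamma_add_one _ (by simp [hτ])]
    ring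
  have h2 : Complex.Gamma (1 - τ * I) = (starRingEnd ℂ) (Complex.Gamma (1 + τ * I)) := by
    rw [← Complex.Gamma_conj]; simp [sub_eq_add_neg]
  have h3 : ‖Complex.sin (Real.pi * (τ * I))‖ = Real.sinh (Real.pi * |τ|) := by
    rw [← mul_assoc, Complex.sin_mul_I, ← Complex.ofReal_mul, ← Complex.ofReal_sinh, norm_mul,
      norm_I, mul_one, Complex.norm_real, Real.norm_eq_abs, Real.abs_sinh, abs_mul,
      abs_of_pos Real.pi_pos]
  have hu : 0 < Real.pi * |τ| := by positivity
  set u := Real.pi * |τ| with hu'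
  have h4 := congrArg norm h1
  rw [h2, norm_mul, RCLike.norm_conj, norm_mul, norm_div, h3, norm_mul, norm_I, Complex.norm_real,
    Complex.norm_real, Real.norm_eq_abs, Real.norm_eq_abs, abs_of_pos Real.pi_pos, mul_one,
    ← mul_div_assoc, mul_comm |τ|, ← hu'] at h4
  have hs : 0 < Real.sinh u := Real.sinh_pos_iff.2 hu
  have h5 : Real.sinh u ≤ u * Real.exp u := by
    rw [Real.sinh_eq]
    have a := Real.add_one_le_exp (-(2*u))
    have b : Real.exp (-u) = Real.exp (-(2*u)) * Real.exp u := by rw [← Real.exp_add]; ring_nf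
    rw [b]
    nlinarith [Real.exp_pos u]
  refine (pow_le_pow_iff_left₀ (by positivity) (by positivity) two_ne_zero).1 ?_
  rw [one_pow, mul_pow, ← Real.exp_nat_mul, sq, h4]
  have : ((2:ℕ):ℝ) * (Real.pi / 2 * |τ|) = u := by rw [hu']; push_cast; ring
  rw [this, div_mul_eq_mul_div, le_div_iff₀ hs]
  linarith

open Complex in
/-- bound with Gamma in the right half plane -/
lemma ml_rgamma_right (z : ℂ) (hz : 1 ≤ z.re) :
    ‖(Complex.Gamma z)⁻¹‖ ≤ (Real.Gamma z.re)⁻¹ * Real.exp (Real.pi / 2 * |z.im|) := by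
  have h1 := ml_gamma_ratio z.re z.im hz
  have h2 := ml_gamma_one z.im
  rw [Complex.re_add_im] at h1
  have hg : 0 < Real.Gamma z.re := Real.Gamma_pos_of_pos (by linarith)
  have h3 : Real.Gamma z.re ≤ ‖Complex.Gamma z‖ * Real.exp (Real.pi / 2 * |z.im|) := by
    calc Real.Gamma z.re = Real.Gamma z.re * 1 := by ring
      _ ≤ Real.Gamma z.re * (‖Complex.Gamma (1 + z.im * I)‖ * Real.exp (Real.pi / 2 * |z.im|)) := by gcongr
      _ = (Real.Gamma z.re * ‖Complex.Gamma (1 + z.im * I)‖) * Real.exp (Real.pi / 2 * |z.im|) := by ring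
      _ ≤ _ := by gcongr
  have hG : 0 < ‖Complex.Gamma z‖ := norm_pos_iff.2 (Complex.Gamma_ne_zero_of_re_pos (by linarith))
  rw [norm_inv, inv_le_iff_one_le_mul₀ hG, ← div_eq_inv_mul, div_mul_eq_mul_div, le_div_iff₀ hg]
  linarith

lemma ml_rgamma_strip (m : ℕ) (b : ℝ) : ∀ δ : ℝ, Real.pi / 2 < δ → 
    ∃ C : ℝ, 0 < C ∧ ∀ z : ℂ, 1 - m ≤ z.re → z.re ≤ b →
      ‖(Complex.Gamma z)⁻¹‖ ≤ C * Real.exp (δ * |z.im|) := by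
  induction m generalizing b with
  | zero =>
    intro δ hδ
    have hc : ContinuousOn (fun σ : ℝ => ‖(Complex.Gamma (σ:ℂ))⁻¹‖) (Set.Icc 1 b) :=
      ((Complex.differentiable_one_div_Gamma.continuous.comp Complex.continuous_ofReal).norm).continuousOn
    obtain ⟨C, hC⟩ := isCompact_Icc.exists_bound_of_continuousOn hc
    refine ⟨max C 1, by positivity, fun z h1 h2 => ?_⟩
    simp at h1
    have h3 := hC z.re ⟨h1, h2⟩
    rw [norm_norm, Complex.Gamma_ofReal, norm_inv, Complex.norm_real,
      Real.norm_of_nonneg (Real.Gamma_pos_of_pos (by linarith)).le] at h3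
    refine (ml_rgamma_right z h1).trans ?_
    gcongr
    exact h3.trans (le_max_left _ _)
  | succ m ih =>
    intro δ hδ
    set ε := (δ - Real.pi / 2) / 2 with hε
    have hε0 : 0 < ε := by rw [hε]; linarith
    obtain ⟨C, hC0, hC⟩ := ih (b + 1) (δ - ε) (by rw [hε]; linarith)
    set A := max 0 (max b m) with hA
    have hA0 : 0 ≤ A := le_max_left _ _
    refine ⟨(A + ε⁻¹) * C, by positivity, fun z h1 h2 => ?_⟩
    push_cast at h1
    have h3 := hC (z + 1) (by simp; linarith) (by simp; linarith)
    have hz : ‖z‖ ≤ (A + ε⁻¹) * Real.exp (ε * |z.im|) := by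
      have h4 : |z.re| ≤ A := abs_le.2 ⟨by have := (le_max_right b (m:ℝ)).trans (le_max_right 0 _); linarith,
        h2.trans ((le_max_left b (m:ℝ)).trans (le_max_right 0 _))⟩
      have h5 := Complex.norm_le_abs_re_add_abs_im z
      have h6 := Real.add_one_le_exp (ε * |z.im|)
      have h7 : 1 ≤ Real.exp (ε * |z.im|) := Real.one_le_exp (by positivity)
      have h8 : |z.im| ≤ ε⁻¹ * Real.exp (ε * |z.im|) := by
        rw [← div_eq_inv_mul, le_div_iff₀ hε0]; linarith
      nlinarith
    rw [Complex.one_div_Gamma_eq_self_mul_one_div_Gamma_add_one, norm_mul]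
    calc _ ≤ ((A + ε⁻¹) * Real.exp (ε * |z.im|)) * (C * Real.exp ((δ - ε) * |(z+1).im|)) := by gcongr
      _ = (A + ε⁻¹) * C * (Real.exp (ε * |z.im|) * Real.exp ((δ - ε) * |z.im|)) := by simp; ring
      _ = _ := by rw [← Real.exp_add]; ring_nf

lemma ml_integrable_exp (a : ℝ) (ha : 0 < a) : MeasureTheory.Integrable (fun t : ℝ => Real.exp (-a * |t|)) := by
  rw [← MeasureTheory.integrableOn_univ, ← Set.Iic_union_Ioi (a := (0:ℝ))]
  apply MeasureTheory.IntegrableOn.union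
  · apply (integrableOn_exp_mul_Iic ha 0).congr_fun _ measurableSet_Iic
    intro t ht
    simp at ht
    simp [abs_of_nonpos ht]
  · apply (integrableOn_exp_mul_Ioi (a := -a) (by linarith) 0).congr_fun _ measurableSet_Ioi
    intro t ht
    simp at ht
    simp [abs_of_pos ht]

lemma ml_integrable_cosh : MeasureTheory.Integrable (fun t : ℝ => (Real.cosh (Real.pi * t))⁻¹) := by
  refine (((ml_integrable_exp Real.pi Real.pi_pos).const_mul 2)).mono' ?_ ?_
  · apply Continuous.aestronglyMeasurable
    have : ∀ t : ℝ, Real.cosh (Real.pi * t) ≠ 0 := fun t => (Real.cosh_pos _).ne'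
    fun_prop (disch := exact this _)
  · refine Filter.Eventually.of_forall fun t => ?_
    rw [Real.norm_of_nonneg (inv_nonneg.2 (Real.cosh_pos _).le), inv_le_iff_one_le_mul₀ (Real.cosh_pos _),
      neg_mul, Real.exp_neg, ← Real.cosh_abs, abs_mul, abs_of_pos Real.pi_pos, Real.cosh_eq]
    have := Real.exp_pos (Real.pi * |t|)
    have := Real.exp_pos (-(Real.pi * |t|))
    field_simp
    linarith

lemma ml_integral_cosh : ∫ t : ℝ, (Real.cosh (Real.pi * t))⁻¹ = 1 := by
  have hd : ∀ t : ℝ, HasDerivAt (fun t => 2 / Real.pi * Real.arctan (Real.exp (Real.pi * t)))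
      ((Real.cosh (Real.pi * t))⁻¹) t := by
    intro t
    have h1 : HasDerivAt (fun t : ℝ => Real.pi * t) Real.pi t := by
      simpa using (hasDerivAt_id t).const_mul Real.pi
    have := ((h1.exp).arctan).const_mul (2 / Real.pi)
    refine this.congr_deriv ?_
    rw [Real.cosh_eq, Real.exp_neg]
    have := Real.exp_pos (Real.pi * t)
    field_simp
    ring
  have hp : Filter.Tendsto (fun t : ℝ => Real.pi * t) Filter.atTop Filter.atTop :=
    Filter.tendsto_id.const_mul_atTop Real.pi_pos
  have hm : Filter.Tendsto (fun t : ℝ => Real.pi * t) Filter.atBot Filter.atBot :=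
    Filter.tendsto_id.const_mul_atBot Real.pi_pos
  have t1 := ((Real.tendsto_arctan_atTop.mono_right nhdsWithin_le_nhds).comp (Real.tendsto_exp_atTop.comp hp)).const_mul (2 / Real.pi)
  have t2 := ((Real.continuous_arctan.tendsto 0).comp (Real.tendsto_exp_atBot.comp hm)).const_mul (2 / Real.pi)
  have := MeasureTheory.integral_of_hasDerivAt_of_tendsto hd ml_integrable_cosh t2 t1
  rw [this, Real.arctan_zero]
  field_simp
  simp

lemma ml_cosh_le (t : ℝ) : (Real.cosh (Real.pi * t))⁻¹ ≤ 2 * Real.exp (-(Real.pi * |t|)) := by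
  rw [inv_le_iff_one_le_mul₀ (Real.cosh_pos _),
      Real.exp_neg, ← Real.cosh_abs, abs_mul, abs_of_pos Real.pi_pos, Real.cosh_eq]
  have := Real.exp_pos (Real.pi * |t|)
  have := Real.exp_pos (-(Real.pi * |t|))
  field_simp
  linarith

open Complex in
lemma ml_sin_ge (s : ℂ) (hs : 1 ≤ |s.im|) :
    Real.exp (Real.pi * |s.im|) / 4 ≤ ‖Complex.sin (Real.pi * s)‖ := by
  have h1 : ‖Complex.exp (-(Real.pi * s) * I)‖ = Real.exp (Real.pi * s.im) := by
    rw [Complex.norm_exp]; simp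
  have h2 : ‖Complex.exp ((Real.pi * s) * I)‖ = Real.exp (-(Real.pi * s.im)) := by
    rw [Complex.norm_exp]; simp
  have h3 := abs_norm_sub_norm_le (Complex.exp (-(Real.pi * s) * I)) (Complex.exp ((Real.pi * s) * I))
  rw [h1, h2] at h3
  have h4 : ‖Complex.sin (Real.pi * s)‖ =
      ‖Complex.exp (-(Real.pi * s) * I) - Complex.exp ((Real.pi * s) * I)‖ / 2 := by
    rw [Complex.sin, norm_div, norm_mul, norm_I]; simp
  have h5 : Real.exp (Real.pi * s.im) - Real.exp (-(Real.pi * s.im)) = 2 * Real.sinh (Real.pi * s.im) := by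
    rw [Real.sinh_eq]; ring
  rw [h5, abs_mul, Real.abs_sinh, abs_mul, abs_of_pos Real.pi_pos, Real.sinh_eq] at h3
  rw [h4]
  have hv : 1 ≤ Real.pi * |s.im| := by nlinarith [Real.pi_gt_three]
  set v := Real.pi * |s.im|
  have h6 := Real.add_one_le_exp v
  have h7 : Real.exp (-v) * Real.exp v = 1 := by rw [← Real.exp_add]; simp
  have h8 : Real.exp (-v) ≤ Real.exp v / 2 := by nlinarith [Real.exp_pos (-v)]
  rw [abs_of_pos (by norm_num : (0:ℝ) < 2)] at h3
  linarith

open Complex in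
lemma ml_shift (G : ℂ → ℂ) (a C : ℝ) (ha : 0 < a)
    (hd : ∀ s : ℂ, |s.re| ≤ 1 / 2 → DifferentiableAt ℂ G s)
    (hb : ∀ s : ℂ, |s.re| ≤ 1 / 2 → 1 ≤ |s.im| → ‖G s‖ ≤ C * Real.exp (-a * |s.im|))
    (i1 : MeasureTheory.Integrable fun t : ℝ => G (((1 / 2 : ℝ) : ℂ) + t * I))
    (i2 : MeasureTheory.Integrable fun t : ℝ => G (((-1 / 2 : ℝ) : ℂ) + t * I)) :
    ∫ t : ℝ, G (((1 / 2 : ℝ) : ℂ) + t * I) = ∫ t : ℝ, G (((-1 / 2 : ℝ) : ℂ) + t * I) := by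
  have t1 := MeasureTheory.intervalIntegral_tendsto_integral i1 Filter.tendsto_neg_atTop_atBot Filter.tendsto_id
  have t2 := MeasureTheory.intervalIntegral_tendsto_integral i2 Filter.tendsto_neg_atTop_atBot Filter.tendsto_id
  have rect : ∀ T : ℝ, (∫ x : ℝ in (-1/2)..(1/2), G (x + ((-T : ℝ) : ℂ) * I)) -
      (∫ x : ℝ in (-1/2)..(1/2), G (x + (T : ℂ) * I)) +
      I • (∫ y : ℝ in (-T)..T, G (((1 / 2 : ℝ) : ℂ) + y * I)) -
      I • (∫ y : ℝ in (-T)..T, G (((-1 / 2 : ℝ) : ℂ) + y * I)) = 0 := by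
    intro T
    have := Complex.integral_boundary_rect_eq_zero_of_differentiableOn G ⟨-1/2, -T⟩ ⟨1/2, T⟩ (by
      intro s hs
      apply (hd s _).differentiableWithinAt
      have := hs.1
      simp only [Set.mem_preimage] at this
      rw [Set.uIcc_of_le (by norm_num)] at this
      exact abs_le.2 ⟨by linarith [this.1], this.2⟩)
    exact this
  have hor : ∀ T : ℝ, 1 ≤ |T| → ‖∫ x : ℝ in (-1/2)..(1/2), G (x + (T : ℂ) * I)‖ ≤ C * Real.exp (-a * |T|) := by
    intro T hT
    have := intervalIntegral.norm_integral_le_of_norm_le_const (a := (-1/2:ℝ)) (b := 1/2)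
      (f := fun x : ℝ => G (x + (T : ℂ) * I)) (C := C * Real.exp (-a * |T|)) (by
        intro x hx
        rw [Set.uIoc_of_le (by norm_num)] at hx
        have := hb (x + T * I) (by simp; exact abs_le.2 ⟨by linarith [hx.1], by linarith [hx.2]⟩) (by simpa using hT)
        simpa using this)
    norm_num at this
    norm_num
    exact this
  have lim : Filter.Tendsto (fun T : ℝ => C * Real.exp (-a * |T|)) Filter.atTop (nhds 0) := by
    have : Filter.Tendsto (fun T : ℝ => -a * |T|) Filter.atTop Filter.atBot :=
      Filter.tendsto_abs_atTop_atTop.const_mul_atTop_of_neg (by linarith)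
    simpa using (Real.tendsto_exp_atBot.comp this).const_mul C
  have l1 : Filter.Tendsto (fun T : ℝ => ∫ x : ℝ in (-1/2)..(1/2), G (x + (T : ℂ) * I)) Filter.atTop (nhds 0) := by
    apply squeeze_zero_norm' _ lim
    filter_upwards [Filter.eventually_ge_atTop 1] with T hT
    exact hor T (by rw [abs_of_pos] <;> linarith)
  have l2 : Filter.Tendsto (fun T : ℝ => ∫ x : ℝ in (-1/2)..(1/2), G (x + ((-T : ℝ) : ℂ) * I)) Filter.atTop (nhds 0) := by
    apply squeeze_zero_norm' _ lim
    filter_upwards [Filter.eventually_ge_atTop 1] with T hT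
    have := hor (-T) (by rw [abs_neg, abs_of_pos] <;> linarith)
    rwa [abs_neg] at this
  have l3 := ((l2.sub l1).add (t1.const_smul I)).sub (t2.const_smul I)
  have l4 := tendsto_nhds_unique (l3.congr (fun T => rect T)) tendsto_const_nhds
  simp only [sub_zero, zero_add, smul_eq_mul] at l4
  exact mul_left_cancel₀ I_ne_zero (sub_eq_zero.1 l4)

/-- numerator of the Mellin-Barnes kernel -/
noncomputable def mlH (α γ L : ℝ) (s : ℂ) : ℂ :=
  Complex.exp (-(s * L)) * (Complex.Gamma (γ - α * s))⁻¹

open Complex in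
/-- Mellin-Barnes integral (on the line Re s = 1/2) -/
noncomputable def mlJ (α γ L : ℝ) : ℂ :=
  ∫ t : ℝ, mlH α γ L (((1 / 2 : ℝ) : ℂ) + t * I) * (((Real.cosh (Real.pi * t))⁻¹ : ℝ) : ℂ)

lemma mlH_diff (α γ L : ℝ) : Differentiable ℂ (mlH α γ L) := by
  unfold mlH
  have h : Differentiable ℂ (fun s : ℂ => (Complex.Gamma (γ - α * s))⁻¹) :=
    Complex.differentiable_one_div_Gamma.comp (f := fun s : ℂ => (γ:ℂ) - α * s) (by fun_prop)
  exact Differentiable.mul (by fun_prop) h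

lemma ml_kappa (α γ : ℝ) (h0 : 0 < α) (h2 : α < 2) : ∃ κ M : ℝ, 0 < κ ∧ κ < Real.pi ∧ 0 < M ∧
    ∀ s : ℂ, |s.re| ≤ 1 / 2 → ‖(Complex.Gamma (γ - α * s))⁻¹‖ ≤ M * Real.exp (κ * |s.im|) := by
  obtain ⟨m, hm⟩ := exists_nat_ge (1 - γ + α)
  have hπ := Real.pi_pos
  have hlt : Real.pi / 2 < Real.pi / α := by gcongr
  set δ := (Real.pi / 2 + Real.pi / α) / 2 with hδ
  have h1 : Real.pi / 2 < δ := by rw [hδ]; linarith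
  have h3 : δ < Real.pi / α := by rw [hδ]; linarith
  obtain ⟨C, hC0, hC⟩ := ml_rgamma_strip m (γ + α) δ h1
  refine ⟨δ * α, C, by positivity, by rwa [lt_div_iff₀ h0] at h3, hC0, fun s hs => ?_⟩
  have hs' := abs_le.1 hs
  have := hC (γ - α * s) (by simp; nlinarith) (by simp; nlinarith)
  simp [abs_mul, abs_of_pos h0] at this
  rw [mul_assoc]
  simpa using this

lemma mlH_norm (α γ L : ℝ) (s : ℂ) : ‖mlH α γ L s‖ =
    Real.exp (-(s.re * L)) * ‖(Complex.Gamma (γ - α * s))⁻¹‖ := by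
  rw [mlH, norm_mul, Complex.norm_exp]; simp

lemma mlH_bound (α γ L : ℝ) (h0 : 0 < α) (h2 : α < 2) : ∃ κ M : ℝ, 0 < κ ∧ κ < Real.pi ∧ 0 < M ∧
    ∀ s : ℂ, |s.re| ≤ 1 / 2 → ‖mlH α γ L s‖ ≤ M * Real.exp (κ * |s.im|) := by
  obtain ⟨κ, M, h1, h3, h4, h5⟩ := ml_kappa α γ h0 h2
  refine ⟨κ, Real.exp |L| * M, h1, h3, by positivity, fun s hs => ?_⟩
  rw [mlH_norm, mul_assoc]
  gcongr
  · have := neg_abs_le (s.re * L)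
    rw [abs_mul] at this
    nlinarith [abs_nonneg L]
  · exact h5 s hs

open Complex in
lemma ml_line_integrable (F : ℝ → ℂ) (hF : Continuous F) (κ M : ℝ) (hκ : κ < Real.pi)
    (hb : ∀ t, ‖F t‖ ≤ M * Real.exp (κ * |t|)) :
    MeasureTheory.Integrable (fun t : ℝ => F t * (((Real.cosh (Real.pi * t))⁻¹ : ℝ) : ℂ)) ∧
    ‖∫ t : ℝ, F t * (((Real.cosh (Real.pi * t))⁻¹ : ℝ) : ℂ)‖ ≤
      M * (2 * ∫ t : ℝ, Real.exp (-(Real.pi - κ) * |t|)) := by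
  have hi := ((ml_integrable_exp (Real.pi - κ) (by linarith)).const_mul 2).const_mul M
  have hn : ∀ t : ℝ, ‖F t * (((Real.cosh (Real.pi * t))⁻¹ : ℝ) : ℂ)‖ ≤
      M * (2 * Real.exp (-(Real.pi - κ) * |t|)) := by
    intro t
    rw [norm_mul, Complex.norm_real, Real.norm_of_nonneg (inv_nonneg.2 (Real.cosh_pos _).le)]
    have hM : 0 ≤ M * Real.exp (κ * |t|) := (norm_nonneg _).trans (hb t)
    calc _ ≤ (M * Real.exp (κ * |t|)) * (2 * Real.exp (-(Real.pi * |t|))) :=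
          mul_le_mul (hb t) (ml_cosh_le t) (inv_nonneg.2 (Real.cosh_pos _).le) hM
      _ = M * (2 * (Real.exp (κ * |t|) * Real.exp (-(Real.pi * |t|)))) := by ring
      _ = _ := by rw [← Real.exp_add]; ring_nf
  have hc : Continuous (fun t : ℝ => (Real.cosh (Real.pi * t))⁻¹) := by
    have : ∀ t : ℝ, Real.cosh (Real.pi * t) ≠ 0 := fun t => (Real.cosh_pos _).ne'
    fun_prop (disch := exact this _)
  refine ⟨hi.mono' (hF.mul (Complex.continuous_ofReal.comp hc)).aestronglyMeasurable
    (Filter.Eventually.of_forall hn), ?_⟩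
  have := MeasureTheory.norm_integral_le_of_norm_le hi (Filter.Eventually.of_forall hn)
  rwa [MeasureTheory.integral_const_mul, MeasureTheory.integral_const_mul] at this

open Complex in
lemma ml_recur (α γ L : ℝ) (h0 : 0 < α) (h2 : α < 2) :
    mlJ α γ L = 2 * (Complex.Gamma γ)⁻¹ - Real.exp L * mlJ α (γ + α) L := by
  obtain ⟨κ, M, hκ0, hκ, hM, hb⟩ := mlH_bound α γ L h0 h2
  set h := mlH α γ L with hh
  have hdiff : Differentiable ℂ h := mlH_diff α γ L
  have hh0 : h 0 = (Complex.Gamma γ)⁻¹ := by simp [hh, mlH]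
  set G : ℂ → ℂ := fun s => dslope h 0 s * (Complex.Gamma (1 + s) * Complex.Gamma (1 - s)) / Real.pi with hG
  have hG1 : ∀ s : ℂ, s ≠ 0 → G s = (h s - h 0) / Complex.sin (Real.pi * s) := by
    intro s hs
    have e : Complex.Gamma (1 + s) * Complex.Gamma (1 - s) = s * (Real.pi / Complex.sin (Real.pi * s)) := by
      rw [← Complex.Gamma_mul_Gamma_one_sub, add_comm, Complex.Gamma_add_one _ hs]; ring
    have hp : (Real.pi : ℂ) ≠ 0 := by exact_mod_cast Real.pi_ne_zero
    simp only [hG]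
    rw [e, dslope_of_ne _ hs, slope_def_field]
    field_simp
    simp
  have hGd : ∀ s : ℂ, |s.re| ≤ 1 / 2 → DifferentiableAt ℂ G s := by
    intro s hs
    have hs' := abs_le.1 hs
    have d1 : DifferentiableAt ℂ (dslope h 0) s := by
      have := (Complex.differentiableOn_dslope (f := h) (c := 0) Filter.univ_mem).2 hdiff.differentiableOn
      exact this.differentiableAt Filter.univ_mem
    have d2 : DifferentiableAt ℂ (fun s => Complex.Gamma (1 + s)) s := by
      apply DifferentiableAt.comp (g := Complex.Gamma) (f := fun s : ℂ => 1 + s) s _ (by fun_prop)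
      apply Complex.differentiableAt_Gamma
      intro m hm
      have := congrArg Complex.re hm
      simp at this
      have : (0:ℝ) ≤ m := by positivity
      linarith
    have d3 : DifferentiableAt ℂ (fun s => Complex.Gamma (1 - s)) s := by
      apply DifferentiableAt.comp (g := Complex.Gamma) (f := fun s : ℂ => 1 - s) s _ (by fun_prop)
      apply Complex.differentiableAt_Gamma
      intro m hm
      have := congrArg Complex.re hm
      simp at this
      have : (0:ℝ) ≤ m := by positivity
      linarith
    exact (d1.mul (d2.mul d3)).div_const _
  have hhb : ∀ s : ℂ, |s.re| ≤ 1 / 2 → ‖h s - h 0‖ ≤ (2 * M) * Real.exp (κ * |s.im|) := by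
    intro s hs
    have a := hb s hs
    have b := hb 0 (by simp)
    simp at b
    have c : 1 ≤ Real.exp (κ * |s.im|) := Real.one_le_exp (by positivity)
    have := norm_sub_le (h s) (h 0)
    nlinarith
  have hGb : ∀ s : ℂ, |s.re| ≤ 1 / 2 → 1 ≤ |s.im| → ‖G s‖ ≤ (8 * M) * Real.exp (-(Real.pi - κ) * |s.im|) := by
    intro s hs hs1
    have hs0 : s ≠ 0 := by rintro rfl; norm_num at hs1
    rw [hG1 s hs0, norm_div]
    have hge := ml_sin_ge s hs1
    have hpos := Real.exp_pos (Real.pi * |s.im|)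
    rw [div_le_iff₀ (by linarith)]
    refine (hhb s hs).trans ?_
    calc _ = (8 * M) * Real.exp (-(Real.pi - κ) * |s.im|) * (Real.exp (Real.pi * |s.im|) / 4) := by
          rw [show κ * |s.im| = -(Real.pi - κ) * |s.im| + Real.pi * |s.im| by ring, Real.exp_add]; ring
      _ ≤ _ := by gcongr
  have sinp : ∀ t : ℝ, Complex.sin (Real.pi * (((1 / 2 : ℝ) : ℂ) + t * I)) = (Real.cosh (Real.pi * t) : ℝ) := by
    intro t
    rw [show (Real.pi : ℂ) * (((1 / 2 : ℝ) : ℂ) + t * I) = (Real.pi * t : ℝ) * I + Real.pi / 2 by push_cast; ring,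
      Complex.sin_add_pi_div_two, Complex.cos_mul_I, Complex.ofReal_cosh]
  have sinm : ∀ t : ℝ, Complex.sin (Real.pi * (((-1 / 2 : ℝ) : ℂ) + t * I)) = -(Real.cosh (Real.pi * t) : ℝ) := by
    intro t
    rw [show (Real.pi : ℂ) * (((-1 / 2 : ℝ) : ℂ) + t * I) = (Real.pi * t : ℝ) * I - Real.pi / 2 by push_cast; ring,
      Complex.sin_sub_pi_div_two, Complex.cos_mul_I, Complex.ofReal_cosh]
  have ne1 : ∀ (c t : ℝ), c ≠ 0 → (c : ℂ) + t * I ≠ 0 := by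
    intro c t hc h
    have := congrArg Complex.re h
    simp at this
    exact hc this
  have Gp : ∀ t : ℝ, G (((1 / 2 : ℝ) : ℂ) + t * I) = h (((1 / 2 : ℝ) : ℂ) + t * I) * (((Real.cosh (Real.pi * t))⁻¹ : ℝ) : ℂ)
      - h 0 * (((Real.cosh (Real.pi * t))⁻¹ : ℝ) : ℂ) := by
    intro t
    rw [hG1 _ (ne1 _ _ (by norm_num)), sinp, div_eq_mul_inv, ← Complex.ofReal_inv, sub_mul]
  have Gm : ∀ t : ℝ, G (((-1 / 2 : ℝ) : ℂ) + t * I) = h 0 * (((Real.cosh (Real.pi * t))⁻¹ : ℝ) : ℂ) -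
      h (((-1 / 2 : ℝ) : ℂ) + t * I) * (((Real.cosh (Real.pi * t))⁻¹ : ℝ) : ℂ) := by
    intro t
    rw [hG1 _ (ne1 _ _ (by norm_num)), sinm, div_eq_mul_inv, inv_neg, ← Complex.ofReal_inv]; ring
  have ic : MeasureTheory.Integrable (fun t : ℝ => h 0 * (((Real.cosh (Real.pi * t))⁻¹ : ℝ) : ℂ)) :=
    (ml_integrable_cosh.ofReal (𝕜 := ℂ)).const_mul _
  have vc : ∫ t : ℝ, h 0 * (((Real.cosh (Real.pi * t))⁻¹ : ℝ) : ℂ) = h 0 := by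
    rw [MeasureTheory.integral_const_mul, integral_complex_ofReal, ml_integral_cosh]; simp
  have hline : ∀ c : ℝ, |c| ≤ 1 / 2 → MeasureTheory.Integrable
      (fun t : ℝ => h ((c : ℂ) + t * I) * (((Real.cosh (Real.pi * t))⁻¹ : ℝ) : ℂ)) := by
    intro c hc
    refine (ml_line_integrable (fun t => h ((c : ℂ) + t * I)) ?_ κ M hκ ?_).1
    · exact hdiff.continuous.comp (by fun_prop)
    · intro t
      simpa using hb (c + t * I) (by simpa using hc)
  have ip := hline (1/2) (by rw [abs_of_pos] <;> norm_num)
  have im := hline (-1/2) (by rw [abs_of_neg] <;> norm_num)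
  have sh := ml_shift G (Real.pi - κ) (8 * M) (by linarith) hGd hGb
    (by simp_rw [Gp]; exact ip.sub ic) (by simp_rw [Gm]; exact ic.sub im)
  simp_rw [Gp, Gm] at sh
  rw [MeasureTheory.integral_sub ip ic, MeasureTheory.integral_sub ic im, vc] at sh
  have hm : ∫ t : ℝ, h (((-1 / 2 : ℝ) : ℂ) + t * I) * (((Real.cosh (Real.pi * t))⁻¹ : ℝ) : ℂ) =
      Real.exp L * mlJ α (γ + α) L := by
    rw [mlJ, ← MeasureTheory.integral_const_mul]
    congr 1
    ext t
    rw [← mul_assoc]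
    congr 1
    simp only [hh, mlH]
    rw [← mul_assoc, Complex.ofReal_exp, ← Complex.exp_add]
    congr 2
    · push_cast; ring
    · congr 1; push_cast; ring
  rw [hm, hh0] at sh
  have : mlJ α γ L = ∫ t : ℝ, h (((1 / 2 : ℝ) : ℂ) + t * I) * (((Real.cosh (Real.pi * t))⁻¹ : ℝ) : ℂ) := rfl
  rw [this]
  linear_combination sh

lemma mlJ_bound (α γ : ℝ) (h0 : 0 < α) (h2 : α < 2) : ∃ C : ℝ, 0 ≤ C ∧ ∀ L : ℝ, 0 ≤ L →
    ‖mlJ α γ L‖ ≤ C := by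
  obtain ⟨κ, M, hκ0, hκ, hM, hb⟩ := ml_kappa α γ h0 h2
  refine ⟨M * (2 * ∫ t : ℝ, Real.exp (-(Real.pi - κ) * |t|)), ?_, fun L hL => ?_⟩
  · have : 0 ≤ ∫ t : ℝ, Real.exp (-(Real.pi - κ) * |t|) :=
      MeasureTheory.integral_nonneg (fun t => (Real.exp_pos _).le)
    positivity
  refine (ml_line_integrable (fun t => mlH α γ L (((1 / 2 : ℝ) : ℂ) + t * Complex.I)) ?_ κ M hκ ?_).2
  · exact (mlH_diff α γ L).continuous.comp (by fun_prop)
  · intro t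
    rw [mlH_norm]
    have := hb (((1 / 2 : ℝ) : ℂ) + t * Complex.I) (by simp)
    have e1 : Real.exp (-((((1 / 2 : ℝ) : ℂ) + t * Complex.I).re * L)) ≤ 1 := by
      rw [Real.exp_le_one_iff]; simp; positivity
    have e2 : (((1 / 2 : ℝ) : ℂ) + t * Complex.I).im = t := by simp
    rw [e2] at this
    calc _ ≤ 1 * (M * Real.exp (κ * |t|)) := by gcongr
      _ = _ := one_mul _

lemma mlJ_tail (α L : ℝ) (h0 : 0 < α) (h2 : α < 2) (hL : 0 ≤ L) : ∃ C : ℝ, ∀ γ : ℝ,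
    1 + α / 2 ≤ γ → ‖mlJ α γ L‖ ≤ (Real.Gamma (γ - α / 2))⁻¹ * C := by
  have hπ := Real.pi_pos
  refine ⟨2 * ∫ t : ℝ, Real.exp (-(Real.pi - Real.pi / 2 * α) * |t|), fun γ hγ => ?_⟩
  refine (ml_line_integrable (fun t => mlH α γ L (((1 / 2 : ℝ) : ℂ) + t * Complex.I)) ?_
    (Real.pi / 2 * α) _ (by nlinarith) ?_).2
  · exact (mlH_diff α γ L).continuous.comp (by fun_prop)
  · intro t
    rw [mlH_norm]
    have e1 : Real.exp (-((((1 / 2 : ℝ) : ℂ) + t * Complex.I).re * L)) ≤ 1 := by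
      rw [Real.exp_le_one_iff]; simp; positivity
    have hre : ((γ : ℂ) - α * (((1 / 2 : ℝ) : ℂ) + t * Complex.I)).re = γ - α / 2 := by
      simp; ring
    have him : |((γ : ℂ) - α * (((1 / 2 : ℝ) : ℂ) + t * Complex.I)).im| = α * |t| := by
      simp [abs_mul, abs_of_pos h0]
    have := ml_rgamma_right ((γ : ℂ) - α * (((1 / 2 : ℝ) : ℂ) + t * Complex.I)) (by rw [hre]; linarith)
    rw [hre, him, ← mul_assoc] at this
    calc _ ≤ 1 * ((Real.Gamma (γ - α / 2))⁻¹ * Real.exp (Real.pi / 2 * α * |t|)) := by gcongr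
      _ = _ := one_mul _

lemma ml_gamma_ge (α b : ℝ) (h1 : 1 < α) : ∀ᶠ k : ℕ in Filter.atTop,
    (k.factorial : ℝ) ≤ Real.Gamma (α * k + b) := by
  have : Filter.Tendsto (fun k : ℕ => (α - 1) * (k:ℝ)) Filter.atTop Filter.atTop :=
    tendsto_natCast_atTop_atTop.const_mul_atTop (by linarith)
  filter_upwards [this.eventually_ge_atTop (1 - b), Filter.eventually_ge_atTop 1] with k hk hk1
  rw [← Real.Gamma_nat_eq_factorial]
  have hk1' : (1:ℝ) ≤ k := by exact_mod_cast hk1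
  exact Real.Gamma_strictMonoOn_Ici.monotoneOn (by simp; linarith) (by simp; nlinarith) (by nlinarith)

lemma ml_summable (α β x : ℝ) (h1 : 1 < α) :
    Summable (fun k : ℕ => x ^ k / Real.Gamma (α * k + β)) := by
  refine Summable.of_norm_bounded_eventually_nat (Real.summable_pow_div_factorial |x|) ?_
  filter_upwards [ml_gamma_ge α β h1] with k hk
  have hf : (0:ℝ) < k.factorial := by exact_mod_cast k.factorial_pos
  rw [norm_div, norm_pow, Real.norm_eq_abs, Real.norm_of_nonneg (by linarith)]
  gcongr

lemma mlJ_eq (α β L : ℝ) (h1 : 1 < α) (h2 : α < 2) (hL : 0 ≤ L) :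
    mlJ α β L = 2 * (mittagLeffler α β (-Real.exp L) : ℝ) := by
  have h0 : 0 < α := by linarith
  set x := Real.exp L with hx
  have iter : ∀ N : ℕ, mlJ α β L = 2 * ((∑ k ∈ Finset.range N, (-x) ^ k / Real.Gamma (α * k + β) : ℝ) : ℂ)
      + (-x) ^ N * mlJ α (α * N + β) L := by
    intro N
    induction N with
    | zero => simp
    | succ N ih =>
      rw [ih, Finset.sum_range_succ, ml_recur α (α * N + β) L h0 h2, Complex.Gamma_ofReal,
        show α * ((N + 1 : ℕ) : ℝ) + β = α * N + β + α by push_cast; ring, ← hx]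
      push_cast
      ring
  have hsum := (ml_summable α β (-x) h1).hasSum.tendsto_sum_nat
  have hsum' := ((Complex.continuous_ofReal.tendsto _).comp hsum).const_mul (2:ℂ)
  obtain ⟨C, hC⟩ := mlJ_tail α L h0 h2 hL
  have tail : Filter.Tendsto (fun N : ℕ => ((-x : ℂ)) ^ N * mlJ α (α * N + β) L) Filter.atTop (nhds 0) := by
    have l : Filter.Tendsto (fun N : ℕ => x ^ N / N.factorial * |C|) Filter.atTop (nhds 0) := by
      simpa using (FloorSemiring.tendsto_pow_div_factorial_atTop x).mul_const |C|
    apply squeeze_zero_norm' _ l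
    have hlin : Filter.Tendsto (fun k : ℕ => α * (k:ℝ)) Filter.atTop Filter.atTop :=
      tendsto_natCast_atTop_atTop.const_mul_atTop h0
    filter_upwards [ml_gamma_ge α (β - α / 2) h1, hlin.eventually_ge_atTop (1 + α / 2 - β)] with N hN hN2
    have hf : (0:ℝ) < N.factorial := by exact_mod_cast N.factorial_pos
    have a := hC (α * N + β) (by linarith)
    rw [show α * N + β - α / 2 = α * N + (β - α / 2) by ring] at a
    have hxp : 0 < x := Real.exp_pos L
    rw [norm_mul, norm_pow, norm_neg, Complex.norm_real, Real.norm_of_nonneg hxp.le, div_eq_mul_inv, mul_assoc]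
    gcongr
    refine a.trans ?_
    have : (Real.Gamma (α * N + (β - α / 2)))⁻¹ ≤ (N.factorial : ℝ)⁻¹ := by gcongr
    have hpos : 0 ≤ (Real.Gamma (α * N + (β - α / 2)))⁻¹ := inv_nonneg.2 (by linarith)
    calc _ ≤ (Real.Gamma (α * N + (β - α / 2)))⁻¹ * |C| := by gcongr; exact le_abs_self C
      _ ≤ _ := by gcongr
  have lim := hsum'.add tail
  have := tendsto_nhds_unique (tendsto_const_nhds (x := mlJ α β L) (f := Filter.atTop (α := ℕ)))
    (lim.congr (fun N => (iter N).symm))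
  rw [this, add_zero]
  rfl

/-- for `1 < α < 2` and `β > 0` there is `C > 0` (depending only on
`α, β`) with `|E_{α,β}(−x)| ≤ C / (1 + x)` for all `x ≥ 0`. -/
theorem mittagLeffler_upper_bound (α β : ℝ) (hα1 : 1 < α) (hα2 : α < 2) (hβ : 0 < β) :
    ∃ C : ℝ, 0 < C ∧ ∀ x : ℝ, 0 ≤ x → |mittagLeffler α β (-x)| ≤ C / (1 + x) := by
  have h0 : 0 < α := by linarith
  obtain ⟨C, hC0, hC⟩ := mlJ_bound α (β - α) h0 hα2
  set S := ∑' k : ℕ, (1:ℝ) ^ k / Real.Gamma (α * k + β) with hS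
  have hpos : ∀ k : ℕ, 0 < Real.Gamma (α * k + β) := fun k => Real.Gamma_pos_of_pos (by positivity)
  have hS0 : 0 ≤ S := tsum_nonneg (fun k => by have := hpos k; positivity)
  set D := ‖2 * (Complex.Gamma ((β - α : ℝ) : ℂ))⁻¹‖ with hD
  have hD0 : 0 ≤ D := norm_nonneg _
  refine ⟨2 * S + D + C + 1, by positivity, fun x hx => ?_⟩
  rw [le_div_iff₀ (by linarith)]
  rcases le_total x 1 with hx1 | hx1
  · have : |mittagLeffler α β (-x)| ≤ S := by
      rw [← Real.norm_eq_abs, mittagLeffler]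
      refine tsum_of_norm_bounded (ml_summable α β 1 hα1).hasSum fun k => ?_
      rw [norm_div, norm_pow, norm_neg, Real.norm_of_nonneg hx, Real.norm_of_nonneg (hpos k).le]
      have := hpos k
      gcongr
    nlinarith [abs_nonneg (mittagLeffler α β (-x))]
  · have hxpos : 0 < x := by linarith
    have hL : 0 ≤ Real.log x := Real.log_nonneg hx1
    have r := ml_recur α (β - α) (Real.log x) h0 hα2
    rw [sub_add_cancel, mlJ_eq α β _ hα1 hα2 hL, Real.exp_log hxpos] at r
    have b := hC _ hL
    have e : (x : ℂ) * (2 * (mittagLeffler α β (-x) : ℝ)) =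
        2 * (Complex.Gamma ((β - α : ℝ) : ℂ))⁻¹ - mlJ α (β - α) (Real.log x) := by
      rw [r]; ring
    have n := congrArg norm e
    rw [norm_mul, norm_mul, Complex.norm_real, Complex.norm_real, Real.norm_of_nonneg hx,
      Real.norm_eq_abs] at n
    have n2 := norm_sub_le (2 * (Complex.Gamma ((β - α : ℝ) : ℂ))⁻¹) (mlJ α (β - α) (Real.log x))
    rw [← n, ← hD] at n2
    norm_num at n2
    nlinarith [abs_nonneg (mittagLeffler α β (-x))]
end

section
/- Let 1 < α < 2. Then there exist constants C > 0 and M > 0 (depending only on α) such that for every x ≥ M, |E_{α,2}(−x) − 1/(Γ(2−α) · x)| ≤ C / x². In other words, E_{α,2}(−x) = 1/(Γ(2−α) x) + O(x^{−2}) as x → ∞. -/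
section
open MeasureTheory Complex Filter Topology

lemma ml_re (c y : ℝ) : ((c:ℂ) + y * I).re = c := by simp

lemma ml_norm_ge (c y : ℝ) (hc : 0 < c) : c ≤ ‖(c:ℂ) + y * I‖ := by
  have := Complex.abs_re_le_norm ((c:ℂ) + y * I)
  rw [ml_re, abs_of_pos hc] at this; exact this

lemma ml_norm_ge' (c y : ℝ) : |y| ≤ ‖(c:ℂ) + y * I‖ := by
  have := Complex.abs_im_le_norm ((c:ℂ) + y * I)
  simpa using this

lemma ml_slit {s : ℂ} (hs : 0 < s.re) : s ∈ slitPlane := Or.inl hs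

lemma ml_int_norm (c b : ℝ) (hc : 0 < c) (hb : 1 < b) :
    Integrable (fun y : ℝ => ‖(c:ℂ) + y * I‖ ^ (-b)) := by
  have h0 : Integrable (fun y : ℝ => (min c 1) ^ (-b) * (1 + ‖y‖ ^ 2) ^ (-b / 2)) := 
    (integrable_rpow_neg_one_add_norm_sq (E := ℝ) (μ := volume) (by simpa using hb)).const_mul _
  refine h0.mono' ?_ (ae_of_all _ fun y => ?_)
  · apply Continuous.aestronglyMeasurable
    apply Continuous.rpow_const (by fun_prop)
    intro y; left
    have := ml_norm_ge c y hc
    linarith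
  · have h1 : min c 1 * (1 + ‖y‖ ^ 2) ^ (1 / 2 : ℝ) ≤ ‖(c:ℂ) + y * I‖ := by
      rw [Complex.norm_add_mul_I, ← Real.sqrt_eq_rpow]
      have hm : 0 < min c 1 := by positivity
      rw [← Real.sqrt_sq hm.le, ← Real.sqrt_mul (by positivity)]
      apply Real.sqrt_le_sqrt
      rw [Real.norm_eq_abs, sq_abs]
      have a1 : min c 1 ≤ c := min_le_left _ _
      have a2 : min c 1 ≤ 1 := min_le_right _ _
      have : (min c 1)^2 ≤ c^2 := by gcongr
      have : (min c 1)^2 ≤ 1 := by nlinarith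
      nlinarith [sq_nonneg y]
    have hm : 0 < min c 1 := by positivity
    have h2 : 0 < min c 1 * (1 + ‖y‖ ^ 2) ^ (1 / 2 : ℝ) := by positivity
    rw [Real.norm_of_nonneg (by positivity)]
    refine (Real.rpow_le_rpow_of_nonpos h2 h1 (by linarith)).trans (le_of_eq ?_)
    rw [Real.mul_rpow hm.le (by positivity), ← Real.rpow_mul (by positivity)]
    congr 2; ring

lemma ml_int_dom (c b K : ℝ) (hc : 0 < c) (hb : 1 < b) (f : ℝ → ℂ) (hf : Continuous f)
    (h : ∀ y : ℝ, ‖f y‖ ≤ K * ‖(c:ℂ) + y * I‖ ^ (-b)) : Integrable f :=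
  ((ml_int_norm c b hc hb).const_mul K).mono' hf.aestronglyMeasurable (ae_of_all _ h)

lemma ml_cont_cpow (c : ℝ) (hc : 0 < c) (z : ℂ) : Continuous (fun y : ℝ => ((c:ℂ) + y * I) ^ z) := by
  apply Continuous.cpow (by fun_prop) (by fun_prop)
  intro y; exact ml_slit (by simpa using hc)

/-- Laplace transform of a power, complex parameter. -/
lemma ml_gamma_complex (z : ℝ) (hz : 0 < z) (r : ℂ) (hr : 0 < r.re) :
    ∫ t : ℝ in Set.Ioi 0, (t:ℂ) ^ ((z:ℂ) - 1) * cexp (-(r * t)) = r ^ (-(z:ℂ)) * Complex.Gamma z := by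
  set d : ℝ → NNReal := fun t => Real.toNNReal (t ^ (z - 1)) with hd
  have hdm : Measurable d := by
    rw [hd]; exact (measurable_id'.pow_const _).real_toNNReal
  set μ : Measure ℝ := (volume.restrict (Set.Ioi 0)).withDensity (fun t => (d t : ENNReal)) with hμ
  have hform : ∀ w : ℂ, ProbabilityTheory.complexMGF id μ w =
      ∫ t : ℝ in Set.Ioi 0, (t:ℂ) ^ ((z:ℂ) - 1) * cexp (w * t) := by
    intro w
    rw [ProbabilityTheory.complexMGF, hμ, integral_withDensity_eq_integral_smul hdm]
    refine setIntegral_congr_fun measurableSet_Ioi fun t ht => ?_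
    have ht' : (0:ℝ) ≤ t := le_of_lt ht
    simp only [hd, NNReal.smul_def, id, Complex.real_smul]
    rw [Real.coe_toNNReal _ (by positivity), Complex.ofReal_cpow ht']
    simp
  have hset : Set.Iio 0 ⊆ ProbabilityTheory.integrableExpSet id μ := by
    intro u hu
    have hu' : u < 0 := hu
    show Integrable _ μ
    rw [hμ, integrable_withDensity_iff_integrable_coe_smul hdm]
    have := integrableOn_rpow_mul_exp_neg_mul_rpow (p := 1) (s := z - 1) (b := -u) (by linarith) one_pos (by linarith)
    refine IntegrableOn.congr_fun this ?_ measurableSet_Ioi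
    intro t ht
    have ht' : (0:ℝ) ≤ t := le_of_lt ht
    simp only [hd, smul_eq_mul, id]
    rw [Real.coe_toNNReal _ (by positivity)]
    simp
  have hA : AnalyticOnNhd ℂ (ProbabilityTheory.complexMGF id μ) {w | w.re < 0} := by
    refine ProbabilityTheory.analyticOnNhd_complexMGF.mono ?_
    intro w hw
    exact interior_maximal hset isOpen_Iio hw
  have hop : IsOpen {w : ℂ | w.re < 0} := isOpen_Iio.preimage Complex.continuous_re
  have hB : AnalyticOnNhd ℂ (fun w : ℂ => (-w) ^ (-(z:ℂ)) * Complex.Gamma z) {w | w.re < 0} := by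
    apply DifferentiableOn.analyticOnNhd _ hop
    intro w hw
    have hw' : w.re < 0 := hw
    apply DifferentiableAt.differentiableWithinAt
    apply DifferentiableAt.mul_const
    apply DifferentiableAt.cpow (by fun_prop) (by fun_prop)
    exact Or.inl (by simpa using hw')
  have hpre : IsPreconnected {w : ℂ | w.re < 0} := by
    exact ((convex_Iio (0:ℝ)).linear_preimage reLm).isPreconnected
  have key := AnalyticOnNhd.eqOn_of_preconnected_of_frequently_eq hA hB hpre (z₀ := ((-1 : ℝ) : ℂ))
    (by simp) (by
      have h_real : ∃ᶠ (x : ℝ) in 𝓝[≠] (-1), x < 0 := by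
        apply Eventually.frequently
        exact eventually_nhdsWithin_of_eventually_nhds (gt_mem_nhds (by norm_num))
      rw [frequently_iff_seq_forall] at h_real ⊢
      obtain ⟨xs, hx_tendsto, hx_eq⟩ := h_real
      refine ⟨fun n ↦ xs n, ?_, fun n ↦ ?_⟩
      · rw [tendsto_nhdsWithin_iff] at hx_tendsto ⊢
        constructor
        · rw [tendsto_ofReal_iff]
          exact hx_tendsto.1
        · filter_upwards [hx_tendsto.2] with n hn
          intro h
          apply hn
          have h' : ((xs n : ℝ) : ℂ) = ((-1 : ℝ) : ℂ) := h
          exact Complex.ofReal_injective h'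
      · have hx := hx_eq n
        have h1 := Complex.integral_cpow_mul_exp_neg_mul_Ioi (a := z) (r := -(xs n))
          (by simpa using hz) (by linarith)
        rw [hform]
        have e : (1 / ((-(xs n) : ℝ) : ℂ)) ^ (z:ℂ) = (-(xs n : ℂ)) ^ (-(z:ℂ)) := by
          rw [one_div, Complex.inv_cpow _ _ (by
            rw [Complex.arg_ofReal_of_nonneg (by linarith)]; exact Real.pi_ne_zero.symm), ← Complex.cpow_neg]
          push_cast; rfl
        rw [e] at h1
        rw [← h1]
        congr 1; ext t; push_cast; ring_nf)
  have := key (show -r ∈ {w : ℂ | w.re < 0} by simpa using hr)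
  rw [hform] at this
  simp only [neg_neg] at this
  rw [← this]
  congr 1; ext t; ring_nf

/-- Bromwich integral for the reciprocal Gamma function. -/
lemma ml_bromwich (c z : ℝ) (hc : 0 < c) (hz : 1 < z) :
    ∫ y : ℝ, cexp ((c:ℂ) + y * I) * ((c:ℂ) + y * I) ^ (-(z:ℂ)) = 2 * Real.pi / Real.Gamma z := by
  set f : ℝ → ℂ := fun t => if 0 < t then (t:ℂ) ^ ((z:ℂ) - 1) * cexp (-(c * t)) else 0 with hf
  have hGam : 0 < Real.Gamma z := Real.Gamma_pos_of_pos (by linarith)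
  have hfi : f = Set.indicator (Set.Ioi 0) (fun t : ℝ => (t:ℂ) ^ ((z:ℂ) - 1) * cexp (-(c * t))) := by
    ext t; simp [hf, Set.indicator]
  have hint : Integrable f := by
    rw [hfi, integrable_indicator_iff measurableSet_Ioi]
    have := integrableOn_rpow_mul_exp_neg_mul_rpow (p := 1) (s := z - 1) (b := c) (by linarith) one_pos hc
    refine IntegrableOn.congr_fun (this.ofReal (𝕜 := ℂ)) ?_ measurableSet_Ioi
    intro t ht
    have ht' : 0 ≤ t := le_of_lt ht
    simp [Complex.ofReal_cpow ht']
  have hF : FourierTransform.fourier f = fun w : ℝ => Real.Gamma z * ((c:ℂ) + (2 * Real.pi * w : ℝ) * I) ^ (-(z:ℂ)) := by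
    ext w
    rw [Real.fourier_real_eq_integral_exp_smul]
    have hre : 0 < ((c:ℂ) + (2 * Real.pi * w : ℝ) * I).re := by rw [ml_re]; exact hc
    have h1 := ml_gamma_complex z (by linarith) ((c:ℂ) + (2 * Real.pi * w : ℝ) * I) hre
    rw [Complex.Gamma_ofReal] at h1
    rw [mul_comm (Real.Gamma z : ℂ), ← h1, ← integral_indicator measurableSet_Ioi]
    congr 1
    ext t
    rw [hfi]
    by_cases ht : 0 < t
    · simp only [Set.indicator, Set.mem_Ioi, ht, if_true, smul_eq_mul]
      rw [mul_left_comm, ← Complex.exp_add]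
      congr 2
      push_cast; ring
    · simp [Set.indicator, ht]
  have hFint : Integrable (FourierTransform.fourier f) := by
    rw [hF]
    have h1 : Integrable (fun y : ℝ => Real.Gamma z * ((c:ℂ) + y * I) ^ (-(z:ℂ))) := by
      refine ml_int_dom c z (Real.Gamma z) hc hz _ ((ml_cont_cpow c hc _).const_mul _) fun y => ?_
      rw [norm_mul, ← Complex.ofReal_neg, Complex.norm_cpow_real]
      simp [abs_of_pos hGam]
    exact h1.comp_mul_left' (by positivity : 2 * Real.pi ≠ 0)
  have hcont : ContinuousAt f 1 := by
    have : ContinuousAt (fun t : ℝ => (t:ℂ) ^ ((z:ℂ) - 1) * cexp (-(c * t))) 1 := by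
      apply ContinuousAt.mul
      · apply ContinuousAt.cpow (by fun_prop) (by fun_prop)
        simp
      · fun_prop
    refine this.congr ?_
    filter_upwards [lt_mem_nhds (zero_lt_one : (0:ℝ) < 1)] with t ht
    simp [hf, ht]
  have hinv := hint.fourierInv_fourier_eq hFint hcont
  rw [Real.fourierInv_eq', hF] at hinv
  have h2 := Measure.integral_comp_mul_left (fun y : ℝ => cexp ((c:ℂ) + y * I) * ((c:ℂ) + y * I) ^ (-(z:ℂ))) (2 * Real.pi)
  have hG : (Real.Gamma z : ℂ) ≠ 0 := by exact_mod_cast hGam.ne'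
  have h3 : ∫ w : ℝ, cexp ((c:ℂ) + (2 * Real.pi * w : ℝ) * I) * ((c:ℂ) + (2 * Real.pi * w : ℝ) * I) ^ (-(z:ℂ)) 
      = cexp c / Real.Gamma z * f 1 := by
    rw [← hinv, ← integral_const_mul]
    congr 1
    ext w
    simp only [smul_eq_mul, Complex.exp_add]
    have : inner ℝ w (1:ℝ) = w := by simp
    rw [this]
    field_simp
  rw [h3] at h2
  have h4 : f 1 = cexp (-c) := by simp [hf]
  rw [h4] at h2
  have hp : (Real.pi : ℂ) ≠ 0 := by exact_mod_cast Real.pi_ne_zero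
  have h5 : cexp c * cexp (-c) = 1 := by rw [← Complex.exp_add]; simp
  rw [abs_of_pos (by positivity), Complex.real_smul] at h2
  have h6 : (((2 * Real.pi)⁻¹ : ℝ) : ℂ) = (2 * Real.pi : ℂ)⁻¹ := by push_cast; rfl
  rw [h6] at h2
  have h7 : cexp c / Real.Gamma z * cexp (-c) = 1 / Real.Gamma z := by
    rw [div_mul_eq_mul_div, h5]
  rw [h7] at h2
  have h8 : (2 * Real.pi : ℂ) ≠ 0 := by simp
  rw [eq_inv_mul_iff_mul_eq₀ h8] at h2
  rw [← h2]; ring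

lemma ml_den (α : ℝ) (hα1 : 1 < α) (hα2 : α < 2) : ∃ κ : ℝ, 0 < κ ∧ ∀ s : ℂ, 0 < s.re → ∀ x : ℝ, 0 < x →
    κ * ‖s‖ ^ α ≤ ‖s ^ (α:ℂ) + x‖ ∧ κ * x ≤ ‖s ^ (α:ℂ) + x‖ := by
  have hpi := Real.pi_pos
  refine ⟨Real.sin (Real.pi / 2 * α), Real.sin_pos_of_pos_of_lt_pi (by positivity) (by nlinarith), ?_⟩
  intro s hs x hx
  set κ := Real.sin (Real.pi / 2 * α) with hκ
  set m := Real.cos (Real.pi / 2 * α) with hm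
  have hκm : κ ^ 2 + m ^ 2 = 1 := Real.sin_sq_add_cos_sq _
  have hκ0 : 0 < κ := Real.sin_pos_of_pos_of_lt_pi (by positivity) (by nlinarith)
  set r := ‖s‖ ^ α with hr
  have hr0 : 0 ≤ r := by positivity
  have hre : r * m ≤ (s ^ (α:ℂ)).re := by
    rw [Complex.cpow_ofReal_re]
    apply mul_le_mul_of_nonneg_left _ hr0
    rw [hm, ← Real.cos_abs (s.arg * α)]
    have h1 : |s.arg| < Real.pi / 2 := Complex.abs_arg_lt_pi_div_two_iff.2 (Or.inl hs)
    apply Real.cos_le_cos_of_nonneg_of_le_pi (abs_nonneg _) (by nlinarith)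
    rw [abs_mul, abs_of_pos (by linarith : 0 < α)]
    gcongr
  have hn : ‖s ^ (α:ℂ)‖ = r := Complex.norm_cpow_real _ _
  have hsq : ‖s ^ (α:ℂ) + x‖ ^ 2 = r ^ 2 + x ^ 2 + 2 * x * (s ^ (α:ℂ)).re := by
    rw [← hn, ← Complex.normSq_eq_norm_sq, ← Complex.normSq_eq_norm_sq, Complex.normSq_apply, Complex.normSq_apply]
    simp; ring
  have hge : r ^ 2 + x ^ 2 + 2 * x * (r * m) ≤ ‖s ^ (α:ℂ) + x‖ ^ 2 := by
    rw [hsq]; gcongr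
  constructor
  · apply abs_le_of_sq_le_sq' _ (norm_nonneg _) |>.2
    nlinarith [sq_nonneg (x + r * m)]
  · apply abs_le_of_sq_le_sq' _ (norm_nonneg _) |>.2
    nlinarith [sq_nonneg (r + x * m)]

lemma ml_cont_line (c : ℝ) (hc : 0 < c) (h : ℂ → ℂ) (hh : ∀ s : ℂ, 0 < s.re → DifferentiableAt ℂ h s) :
    Continuous (fun y : ℝ => h ((c:ℂ) + y * I)) := by
  rw [continuous_iff_continuousAt]
  intro y
  have h1 := (hh ((c:ℂ) + y * I) (by rw [ml_re]; exact hc)).continuousAt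
  exact ContinuousAt.comp (f := fun y : ℝ => (c:ℂ) + y * I) h1 (by fun_prop)

lemma ml_shift_s2 (h : ℂ → ℂ) (hh : ∀ s : ℂ, 0 < s.re → DifferentiableAt ℂ h s) (a b : ℝ) (ha : 0 < a) (hb : 0 < b)
    (φ : ℝ → ℝ) (hφ : Tendsto φ atTop (𝓝 0)) 
    (hbd : ∀ u ∈ Set.uIcc a b, ∀ y : ℝ, ‖h ((u:ℂ) + y * I)‖ ≤ φ |y|)
    (hia : Integrable (fun y : ℝ => h ((a:ℂ) + y * I))) (hib : Integrable (fun y : ℝ => h ((b:ℂ) + y * I))) :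
    ∫ y : ℝ, h ((a:ℂ) + y * I) = ∫ y : ℝ, h ((b:ℂ) + y * I) := by
  have ta := intervalIntegral_tendsto_integral hia tendsto_neg_atTop_atBot tendsto_id
  have tb := intervalIntegral_tendsto_integral hib tendsto_neg_atTop_atBot tendsto_id
  have hrect : ∀ T : ℝ, (∫ y in (-T)..T, h ((b:ℂ) + y * I)) - (∫ y in (-T)..T, h ((a:ℂ) + y * I)) =
      I * ((∫ u in a..b, h ((u:ℂ) + (-T : ℝ) * I)) - ∫ u in a..b, h ((u:ℂ) + (T:ℝ) * I)) := by
    intro T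
    have := Complex.integral_boundary_rect_eq_zero_of_differentiableOn h ((a:ℂ) + (-T : ℝ) * I) ((b:ℂ) + (T:ℝ) * I) (by
      intro s hs
      apply (hh s _).differentiableWithinAt
      have := hs.1
      simp only [Set.mem_preimage, ml_re] at this
      rcases Set.mem_uIcc.1 this with h | h <;> linarith [h.1])
    simp only [ml_re, smul_eq_mul] at this
    have e1 : ∀ p q : ℝ, ((p:ℂ) + (q:ℂ) * I).im = q := by intro p q; simp
    simp only [e1] at this
    linear_combination (-I) * this + (-(∫ y in (-T)..T, h ((a:ℂ) + y * I)) + (∫ y in (-T)..T, h ((b:ℂ) + y * I))) * Complex.I_sq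
  have hlim : Tendsto (fun T : ℝ => I * ((∫ u in a..b, h ((u:ℂ) + (-T : ℝ) * I)) - ∫ u in a..b, h ((u:ℂ) + (T:ℝ) * I))) atTop (𝓝 0) := by
    have hz : Tendsto (fun T : ℝ => 2 * (φ T * |b - a|)) atTop (𝓝 0) := by
      simpa using (hφ.mul_const |b - a|).const_mul 2
    refine squeeze_zero_norm' ?_ hz
    filter_upwards [eventually_ge_atTop 0] with T hT
    rw [norm_mul, Complex.norm_I, one_mul]
    refine (norm_sub_le _ _).trans ?_
    have b1 : ‖∫ u in a..b, h ((u:ℂ) + (-T : ℝ) * I)‖ ≤ φ T * |b - a| := by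
      apply intervalIntegral.norm_integral_le_of_norm_le_const
      intro u hu
      have := hbd u (Set.uIoc_subset_uIcc hu) (-T)
      rwa [abs_neg, abs_of_nonneg hT] at this
    have b2 : ‖∫ u in a..b, h ((u:ℂ) + (T : ℝ) * I)‖ ≤ φ T * |b - a| := by
      apply intervalIntegral.norm_integral_le_of_norm_le_const
      intro u hu
      have := hbd u (Set.uIoc_subset_uIcc hu) T
      rwa [abs_of_nonneg hT] at this
    linarith
  have hd := tb.sub ta
  have := tendsto_nhds_unique hd (hlim.congr fun T => (hrect T).symm)
  exact (sub_eq_zero.1 this).symm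

lemma ml_ibp (c : ℝ) (hc : 0 < c) (G G' : ℂ → ℂ) (hG : ∀ s : ℂ, 0 < s.re → HasDerivAt G (G' s) s)
    (hi : Integrable (fun y : ℝ => cexp ((c:ℂ) + y * I) * G ((c:ℂ) + y * I)))
    (hi' : Integrable (fun y : ℝ => cexp ((c:ℂ) + y * I) * G' ((c:ℂ) + y * I))) :
    ∫ y : ℝ, cexp ((c:ℂ) + y * I) * G ((c:ℂ) + y * I) = -∫ y : ℝ, cexp ((c:ℂ) + y * I) * G' ((c:ℂ) + y * I) := by
  have hd : ∀ y : ℝ, HasDerivAt (fun y : ℝ => cexp ((c:ℂ) + y * I) * G ((c:ℂ) + y * I))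
      ((cexp ((c:ℂ) + y * I) * G ((c:ℂ) + y * I) + cexp ((c:ℂ) + y * I) * G' ((c:ℂ) + y * I)) * I) y := by
    intro y
    have h1 : HasDerivAt (fun y : ℝ => (c:ℂ) + y * I) I y := by
      simpa using ((Complex.ofRealCLM.hasDerivAt (x := y)).mul_const I).const_add (c:ℂ)
    have h2 := (Complex.hasDerivAt_exp ((c:ℂ) + y * I)).mul (hG ((c:ℂ) + y * I) (by rw [ml_re]; exact hc))
    exact h2.comp y h1
  have := integral_eq_zero_of_hasDerivAt_of_integrable hd ((hi.add hi').mul_const I) hi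
  rw [integral_mul_const, integral_add hi hi'] at this
  have h3 := (mul_eq_zero.1 this).resolve_right Complex.I_ne_zero
  exact eq_neg_of_add_eq_zero_left h3

noncomputable def mlG (α x : ℝ) (s : ℂ) : ℂ := s ^ ((α:ℂ) - 2) / (s ^ (α:ℂ) + x)

noncomputable def mlp (α x : ℝ) (s : ℂ) : ℂ := s ^ (α:ℂ) / (s ^ (α:ℂ) + x)

noncomputable def mlD (α : ℝ) (β : ℂ) (P : Polynomial ℂ) : Polynomial ℂ :=
  Polynomial.C β * P + Polynomial.C (α:ℂ) * Polynomial.X * (1 - Polynomial.X) * Polynomial.derivative P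

lemma ml_den_ne (α : ℝ) (hα1 : 1 < α) (hα2 : α < 2) (x : ℝ) (hx : 0 < x) (s : ℂ) (hs : 0 < s.re) :
    s ^ (α:ℂ) + x ≠ 0 := by
  obtain ⟨κ, hκ, h⟩ := ml_den α hα1 hα2
  have := (h s hs x hx).2
  intro h0
  rw [h0, norm_zero] at this
  nlinarith

lemma ml_ne {s : ℂ} (hs : 0 < s.re) : s ≠ 0 := by
  rintro rfl; simp at hs

lemma ml_deriv (α : ℝ) (hα1 : 1 < α) (hα2 : α < 2) (x : ℝ) (hx : 0 < x) (β : ℂ) (P : Polynomial ℂ)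
    (s : ℂ) (hs : 0 < s.re) :
    HasDerivAt (fun s => s ^ β * P.eval (mlp α x s)) (s ^ (β - 1) * (mlD α β P).eval (mlp α x s)) s := by
  have hs0 := ml_ne hs
  have hden := ml_den_ne α hα1 hα2 x hx s hs
  have h1 : ∀ γ : ℂ, HasDerivAt (fun s : ℂ => s ^ γ) (γ * s ^ (γ - 1)) s := fun γ => by
    simpa using (hasDerivAt_id s).cpow_const (c := γ) (ml_slit hs)
  have hp : HasDerivAt (mlp α x) (α * mlp α x s * (1 - mlp α x s) / s) s := by
    have := (h1 α).div ((h1 α).add_const (x:ℂ)) hden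
    convert! this using 1
    rw [Complex.cpow_sub _ _ hs0, Complex.cpow_one]
    unfold mlp
    field_simp
  have h2 := (h1 β).mul ((P.hasDerivAt (mlp α x s)).comp s hp)
  convert! h2 using 1
  rw [Complex.cpow_sub _ _ hs0, Complex.cpow_one]
  simp only [mlD, Polynomial.eval_add, Polynomial.eval_mul, Polynomial.eval_C, Polynomial.eval_X, Polynomial.eval_sub, Polynomial.eval_one]
  simp only [Function.comp]
  field_simp

lemma ml_poly_bd (P : Polynomial ℂ) (K : ℝ) : ∃ B : ℝ, 0 ≤ B ∧ ∀ w : ℂ, ‖w‖ ≤ K → ‖P.eval w‖ ≤ B := by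
  obtain ⟨B, hB⟩ := (isCompact_closedBall (0:ℂ) K).exists_bound_of_continuousOn (f := fun w => P.eval w) P.continuous.continuousOn
  refine ⟨max B 0, le_max_right _ _, fun w hw => (hB w (by simpa using hw)).trans (le_max_left _ _)⟩

lemma ml_poly_lip (P : Polynomial ℂ) (K : ℝ) : ∃ B : ℝ, 0 ≤ B ∧ ∀ w : ℂ, ‖w‖ ≤ K → ‖P.eval w - P.eval 0‖ ≤ B * ‖w‖ := by
  obtain ⟨B, hB0, hB⟩ := ml_poly_bd P.divX K
  refine ⟨B, hB0, fun w hw => ?_⟩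
  have e : P.eval w - P.eval 0 = P.divX.eval w * w := by
    conv_lhs => rw [← Polynomial.divX_mul_X_add P]
    simp
  rw [e, norm_mul]
  gcongr
  exact hB w hw

lemma mlG_diff (α : ℝ) (hα1 : 1 < α) (hα2 : α < 2) (x : ℝ) (hx : 0 < x) (s : ℂ) (hs : 0 < s.re) :
    DifferentiableAt ℂ (mlG α x) s := by
  have hden := ml_den_ne α hα1 hα2 x hx s hs
  have h1 : ∀ γ : ℂ, DifferentiableAt ℂ (fun s : ℂ => s ^ γ) s := fun γ => 
    ((hasDerivAt_id s).cpow_const (c := γ) (ml_slit hs)).differentiableAt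
  exact (h1 _).div ((h1 _).add_const _) hden

lemma mlG_bd (α : ℝ) (κ x : ℝ) (hκ : 0 < κ) (s : ℂ) (hs : s ≠ 0)
    (h : κ * ‖s‖ ^ α ≤ ‖s ^ (α:ℂ) + x‖) : ‖mlG α x s‖ ≤ κ⁻¹ * ‖s‖ ^ (-2 : ℝ) := by
  have hs0 : 0 < ‖s‖ := norm_pos_iff.2 hs
  unfold mlG
  rw [norm_div]
  have e : ((α:ℂ) - 2) = ((α - 2 : ℝ) : ℂ) := by push_cast; rfl
  rw [e, Complex.norm_cpow_real]
  have : 0 < ‖s‖ ^ α := by positivity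
  calc ‖s‖ ^ (α - 2) / ‖s ^ (α:ℂ) + x‖ ≤ ‖s‖ ^ (α - 2) / (κ * ‖s‖ ^ α) := by gcongr
    _ = κ⁻¹ * ‖s‖ ^ (-2 : ℝ) := by
      rw [sub_eq_add_neg, Real.rpow_add hs0]
      field_simp

lemma ml_exp_norm (c y : ℝ) : ‖cexp ((c:ℂ) + y * I)‖ = Real.exp c := by
  rw [Complex.norm_exp, ml_re]

lemma ml_series (α : ℝ) (hα1 : 1 < α) (x : ℝ) (hx : 0 < x) (c : ℝ) (hc : 0 < c) (hxc : x < c ^ α) :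
    ∫ y : ℝ, cexp ((c:ℂ) + y * I) * mlG α x ((c:ℂ) + y * I) = 2 * Real.pi * mittagLeffler α 2 (-x) := by
  set F : ℕ → ℝ → ℂ := fun k y => (-x:ℂ) ^ k * (cexp ((c:ℂ) + y * I) * ((c:ℂ) + y * I) ^ (-((α * k + 2 : ℝ) : ℂ))) with hF
  have hq0 : 0 ≤ x * c ^ (-α) := by positivity
  have hq1 : x * c ^ (-α) < 1 := by
    rw [Real.rpow_neg hc.le, ← div_eq_mul_inv, div_lt_one (by positivity)]; exact hxc
  have hne : ∀ y : ℝ, (c:ℂ) + y * I ≠ 0 := fun y => ml_ne (by rw [ml_re]; exact hc)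
  have hb : ∀ k y, ‖F k y‖ ≤ (Real.exp c * (x * c ^ (-α)) ^ k) * ‖(c:ℂ) + y * I‖ ^ (-2 : ℝ) := by
    intro k y
    have hs0 : 0 < ‖(c:ℂ) + y * I‖ := norm_pos_iff.2 (hne y)
    simp only [hF]
    rw [norm_mul, norm_mul, ml_exp_norm, norm_pow, norm_neg, Complex.norm_real, Real.norm_of_nonneg hx.le,
      ← Complex.ofReal_neg, Complex.norm_cpow_real]
    have e : -(α * k + 2) = -(α * k) + (-2) := by ring
    rw [e, Real.rpow_add hs0, mul_pow, ← Real.rpow_natCast (c ^ (-α)), ← Real.rpow_mul hc.le]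
    have e2 : ‖(c:ℂ) + y * I‖ ^ (-(α * k)) ≤ c ^ (-α * k) := by
      rw [← neg_mul]
      apply Real.rpow_le_rpow_of_nonpos hc (ml_norm_ge c y hc)
      have : 0 ≤ α * k := by positivity
      linarith
    calc x ^ k * (Real.exp c * (‖(c:ℂ) + y * I‖ ^ (-(α * k)) * ‖(c:ℂ) + y * I‖ ^ (-2:ℝ)))
        ≤ x ^ k * (Real.exp c * (c ^ (-α * k) * ‖(c:ℂ) + y * I‖ ^ (-2:ℝ))) := by gcongr
      _ = _ := by ring
  have hFi : ∀ k, Integrable (F k) := by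
    intro k
    refine ml_int_dom c 2 _ hc (by norm_num) _ ?_ (hb k)
    have := ml_cont_cpow c hc (-((α * k + 2 : ℝ) : ℂ))
    simp only [hF]
    fun_prop
  have hsum : Summable fun k => ∫ y, ‖F k y‖ := by
    have hg := (((summable_geometric_of_lt_one hq0 hq1).mul_left (Real.exp c)).mul_right (∫ y : ℝ, ‖(c:ℂ) + y * I‖ ^ (-2:ℝ)))
    refine Summable.of_nonneg_of_le (fun k => integral_nonneg fun y => norm_nonneg _) (fun k => ?_) hg
    rw [← integral_const_mul]
    exact integral_mono (hFi k).norm ((ml_int_norm c 2 hc (by norm_num)).const_mul _) (hb k)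
  have hS := hasSum_integral_of_summable_integral_norm hFi hsum
  have hI : ∀ k, ∫ y, F k y = ((2 * Real.pi * ((-x) ^ k / Real.Gamma (α * k + 2)) : ℝ) : ℂ) := by
    intro k
    simp only [hF]
    have hk : 0 ≤ α * k := by positivity
    rw [integral_const_mul, ml_bromwich c (α * k + 2) hc (by linarith)]
    push_cast; ring
  have hT : ∀ y : ℝ, ∑' k, F k y = cexp ((c:ℂ) + y * I) * mlG α x ((c:ℂ) + y * I) := by
    intro y
    set s := (c:ℂ) + y * I with hs
    have hs0 : s ≠ 0 := hne y
    have hsp : 0 < ‖s‖ := norm_pos_iff.2 hs0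
    have hsa : s ^ (α:ℂ) ≠ 0 := by simp [Complex.cpow_eq_zero_iff, hs0]
    have e : ∀ k, F k y = cexp s * s ^ (-2:ℂ) * (-x / s ^ (α:ℂ)) ^ k := by
      intro k
      simp only [hF]
      have : (-((α * k + 2 : ℝ) : ℂ)) = (-2:ℂ) + (-(α:ℂ)) * (k:ℕ) := by push_cast; ring
      rw [this, Complex.cpow_add _ _ hs0, Complex.cpow_mul_nat, Complex.cpow_neg _ (α:ℂ), div_eq_mul_inv, mul_pow]
      ring
    have hlt : ‖(-x / s ^ (α:ℂ) : ℂ)‖ < 1 := by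
      rw [norm_div, norm_neg, Complex.norm_real, Real.norm_of_nonneg hx.le, Complex.norm_cpow_real, div_lt_one (by positivity)]
      refine hxc.trans_le ?_
      apply Real.rpow_le_rpow hc.le (ml_norm_ge c y hc) (by linarith)
    simp_rw [e]
    rw [tsum_mul_left, tsum_geometric_of_norm_lt_one hlt]
    unfold mlG
    rw [Complex.cpow_sub _ _ hs0, Complex.cpow_neg]
    have : (1 - (-x / s ^ (α:ℂ) : ℂ)) = (s ^ (α:ℂ) + x) / s ^ (α:ℂ) := by field_simp; ring
    rw [this, inv_div]
    field_simp
  simp_rw [hT] at hS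
  rw [← hS.tsum_eq]
  simp_rw [hI]
  rw [← Complex.ofReal_tsum, tsum_mul_left]
  simp [mittagLeffler]

lemma mlG_int (α : ℝ) (hα1 : 1 < α) (hα2 : α < 2) (x : ℝ) (hx : 0 < x) (c : ℝ) (hc : 0 < c) :
    Integrable (fun y : ℝ => cexp ((c:ℂ) + y * I) * mlG α x ((c:ℂ) + y * I)) := by
  obtain ⟨κ, hκ, h⟩ := ml_den α hα1 hα2
  refine ml_int_dom c 2 (Real.exp c * κ⁻¹) hc (by norm_num) _ ?_ fun y => ?_
  · have := ml_cont_line c hc (mlG α x) (mlG_diff α hα1 hα2 x hx)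
    fun_prop
  · have hre : 0 < ((c:ℂ) + y * I).re := by rw [ml_re]; exact hc
    rw [norm_mul, ml_exp_norm, mul_assoc]
    gcongr
    exact mlG_bd α κ x hκ _ (ml_ne hre) (h _ hre x hx).1

lemma ml_line_one (α : ℝ) (hα1 : 1 < α) (hα2 : α < 2) (x : ℝ) (hx : 0 < x) :
    ∫ y : ℝ, cexp (((1:ℝ):ℂ) + y * I) * mlG α x (((1:ℝ):ℂ) + y * I) = 2 * Real.pi * mittagLeffler α 2 (-x) := by
  obtain ⟨κ, hκ, h⟩ := ml_den α hα1 hα2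
  set c : ℝ := 1 + x with hcd
  have hc : 0 < c := by positivity
  have hc1 : 1 ≤ c := by linarith
  have hxc : x < c ^ α := by
    have : c ^ (1:ℝ) ≤ c ^ α := Real.rpow_le_rpow_of_exponent_le hc1 hα1.le
    rw [Real.rpow_one] at this
    linarith
  rw [← ml_series α hα1 x hx c hc hxc]
  refine ml_shift_s2 (fun s => cexp s * mlG α x s) ?_ 1 c one_pos hc (fun T => Real.exp c * (κ⁻¹ * (max T 1) ^ (-2:ℝ))) ?_ ?_
    (mlG_int α hα1 hα2 x hx 1 one_pos) (mlG_int α hα1 hα2 x hx c hc)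
  · intro s hs
    exact (Complex.differentiable_exp s).mul (mlG_diff α hα1 hα2 x hx s hs)
  · have h1 : Tendsto (fun T : ℝ => max T 1) atTop atTop := tendsto_atTop_mono (fun T => le_max_left _ _) tendsto_id
    have h2 := (tendsto_rpow_neg_atTop (y := 2) (by norm_num)).comp h1
    simpa using (h2.const_mul κ⁻¹).const_mul (Real.exp c)
  · intro u hu y
    rw [Set.uIcc_of_le hc1] at hu
    have hu0 : 0 < u := by linarith [hu.1]
    have hre : 0 < ((u:ℂ) + y * I).re := by rw [ml_re]; exact hu0
    rw [norm_mul, ml_exp_norm]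
    have hb := mlG_bd α κ x hκ _ (ml_ne hre) (h _ hre x hx).1
    have hm : max |y| 1 ≤ ‖(u:ℂ) + y * I‖ := max_le (ml_norm_ge' u y) (hu.1.trans (ml_norm_ge u y hu0))
    have h3 : ‖(u:ℂ) + y * I‖ ^ (-2:ℝ) ≤ (max |y| 1) ^ (-2:ℝ) :=
      Real.rpow_le_rpow_of_nonpos (by positivity) hm (by norm_num)
    have h4 : Real.exp u ≤ Real.exp c := Real.exp_le_exp.2 hu.2
    have h5 : ‖mlG α x ((u:ℂ) + y * I)‖ ≤ κ⁻¹ * (max |y| 1) ^ (-2:ℝ) := hb.trans (by gcongr)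
    gcongr

lemma mlp_bd (α κ x : ℝ) (hκ : 0 < κ) (hx : 0 < x) (s : ℂ) (hs : s ≠ 0)
    (h : κ * ‖s‖ ^ α ≤ ‖s ^ (α:ℂ) + x‖ ∧ κ * x ≤ ‖s ^ (α:ℂ) + x‖) :
    ‖mlp α x s‖ ≤ κ⁻¹ ∧ ‖mlp α x s‖ ≤ κ⁻¹ * ‖s‖ ^ α / x := by
  have hs0 : 0 < ‖s‖ := norm_pos_iff.2 hs
  have hp : 0 < ‖s‖ ^ α := by positivity
  unfold mlp
  rw [norm_div, Complex.norm_cpow_real]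
  have hd : 0 < κ * x := by positivity
  constructor
  · calc ‖s‖ ^ α / ‖s ^ (α:ℂ) + x‖ ≤ ‖s‖ ^ α / (κ * ‖s‖ ^ α) := by gcongr; exact h.1
      _ = κ⁻¹ := by field_simp
  · calc ‖s‖ ^ α / ‖s ^ (α:ℂ) + x‖ ≤ ‖s‖ ^ α / (κ * x) := by gcongr; exact h.2
      _ = _ := by field_simp

lemma ml_int_poly (α : ℝ) (hα1 : 1 < α) (hα2 : α < 2) (x : ℝ) (hx : 0 < x) (β : ℝ) (hβ : β < -1) (P : Polynomial ℂ) :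
    Integrable (fun y : ℝ => cexp (((1:ℝ):ℂ) + y * I) *
      ((((1:ℝ):ℂ) + y * I) ^ (β:ℂ) * P.eval (mlp α x (((1:ℝ):ℂ) + y * I)))) := by
  obtain ⟨κ, hκ, h⟩ := ml_den α hα1 hα2
  obtain ⟨B, hB0, hB⟩ := ml_poly_bd P κ⁻¹
  refine ml_int_dom 1 (-β) (Real.exp 1 * B) one_pos (by linarith) _ ?_ fun y => ?_
  · have := ml_cont_line 1 one_pos (fun s => s ^ (β:ℂ) * P.eval (mlp α x s))
      (fun s hs => (ml_deriv α hα1 hα2 x hx β P s hs).differentiableAt)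
    fun_prop
  · have hre : 0 < (((1:ℝ):ℂ) + y * I).re := by rw [ml_re]; exact one_pos
    have h1 := hB _ (mlp_bd α κ x hκ hx _ (ml_ne hre) (h _ hre x hx)).1
    rw [norm_mul, norm_mul, ml_exp_norm, Complex.norm_cpow_real, neg_neg, mul_assoc, mul_comm B]
    gcongr

/-- for `1 < α < 2` there are `C > 0`, `M > 0` (depending only on `α`)
such that `|E_{α,2}(−x) − 1/(Γ(2−α)·x)| ≤ C / x²` for all `x ≥ M`. -/
theorem mittagLeffler_asymptotic (α : ℝ) (hα1 : 1 < α) (hα2 : α < 2) :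
    ∃ C : ℝ, 0 < C ∧ ∃ M : ℝ, 0 < M ∧ ∀ x : ℝ, M ≤ x →
      |mittagLeffler α 2 (-x) - 1 / (Real.Gamma (2 - α) * x)| ≤ C / x ^ 2 := by
  obtain ⟨κ, hκ, hden⟩ := ml_den α hα1 hα2
  set P0 : Polynomial ℂ := 1 - Polynomial.X with hP0
  set P1 := mlD α ((α - 2 : ℝ) : ℂ) P0 with hP1
  set P2 := mlD α ((α - 3 : ℝ) : ℂ) P1 with hP2
  set P3 := mlD α ((α - 4 : ℝ) : ℂ) P2 with hP3
  have hP30 : P3.eval 0 = -(((2 - α) * (3 - α) * (4 - α) : ℝ) : ℂ) := by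
    simp [hP3, hP2, hP1, hP0, mlD]; ring
  obtain ⟨B, hB0, hB⟩ := ml_poly_lip P3 κ⁻¹
  set J : ℝ := ∫ y : ℝ, ‖((1:ℝ):ℂ) + y * I‖ ^ (-(5 - 2 * α)) with hJ
  have hJi := ml_int_norm 1 (5 - 2 * α) one_pos (by linarith)
  have hJ0 : 0 ≤ J := integral_nonneg fun y => by positivity
  refine ⟨Real.exp 1 * B * κ⁻¹ * J + 1, by positivity, 1, one_pos, fun x hx1 => ?_⟩
  have hx : 0 < x := by linarith
  have hxC : (x:ℂ) ≠ 0 := by exact_mod_cast hx.ne'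
  -- integration by parts
  have st : ∀ (β : ℝ) (P : Polynomial ℂ), ∀ s : ℂ, 0 < s.re → HasDerivAt (fun s => s ^ (β:ℂ) * P.eval (mlp α x s))
      (s ^ ((β - 1 : ℝ) : ℂ) * (mlD α β P).eval (mlp α x s)) s := by
    intro β P s hs
    have := ml_deriv α hα1 hα2 x hx β P s hs
    push_cast; exact this
  have hG0 : ∀ s : ℂ, 0 < s.re → s ^ ((α - 2 : ℝ) : ℂ) * P0.eval (mlp α x s) = x * mlG α x s := by
    intro s hs
    have hd := ml_den_ne α hα1 hα2 x hx s hs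
    simp only [hP0, mlp, mlG, Polynomial.eval_sub, Polynomial.eval_one, Polynomial.eval_X]
    push_cast
    field_simp
    ring
  have hline : ∀ y : ℝ, 0 < (((1:ℝ):ℂ) + y * I).re := fun y => by rw [ml_re]; exact one_pos
  have e0 : (fun y : ℝ => cexp (((1:ℝ):ℂ) + y * I) * ((((1:ℝ):ℂ) + y * I) ^ ((α - 2 : ℝ) : ℂ) * P0.eval (mlp α x (((1:ℝ):ℂ) + y * I))))
      = fun y : ℝ => x * (cexp (((1:ℝ):ℂ) + y * I) * mlG α x (((1:ℝ):ℂ) + y * I)) := by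
    ext y
    rw [hG0 _ (hline y)]; ring
  have i0 : Integrable (fun y : ℝ => cexp (((1:ℝ):ℂ) + y * I) * ((((1:ℝ):ℂ) + y * I) ^ ((α - 2 : ℝ) : ℂ) * P0.eval (mlp α x (((1:ℝ):ℂ) + y * I)))) := by
    rw [e0]; exact (mlG_int α hα1 hα2 x hx 1 one_pos).const_mul _
  have a3 : α - 2 - 1 = α - 3 := by ring
  have a4 : α - 3 - 1 = α - 4 := by ring
  have a5 : α - 4 - 1 = α - 5 := by ring
  have i1 := ml_int_poly α hα1 hα2 x hx (α - 3) (by linarith) P1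
  have i2 := ml_int_poly α hα1 hα2 x hx (α - 4) (by linarith) P2
  have i3 := ml_int_poly α hα1 hα2 x hx (α - 5) (by linarith) P3
  have s0 := st (α - 2) P0
  have s1 := st (α - 3) P1
  have s2 := st (α - 4) P2
  rw [a3] at s0
  rw [a4] at s1
  rw [a5] at s2
  have b1 := ml_ibp 1 one_pos _ _ s0 i0 i1
  have b2 := ml_ibp 1 one_pos _ _ s1 i1 i2
  have b3 := ml_ibp 1 one_pos _ _ s2 i2 i3
  rw [b2, b3, e0, integral_const_mul, ml_line_one α hα1 hα2 x hx] at b1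
  -- leading term
  have hbr := ml_bromwich 1 (5 - α) one_pos (by linarith)
  have hneg : (-((5 - α : ℝ) : ℂ)) = ((α - 5 : ℝ) : ℂ) := by push_cast; ring
  rw [hneg] at hbr
  have hGam : Real.Gamma (5 - α) = (4 - α) * ((3 - α) * ((2 - α) * Real.Gamma (2 - α))) := by
    have g1 := Real.Gamma_add_one (s := 2 - α) (by linarith)
    have g2 := Real.Gamma_add_one (s := 3 - α) (by linarith)
    have g3 := Real.Gamma_add_one (s := 4 - α) (by linarith)
    rw [show 2 - α + 1 = 3 - α by ring] at g1
    rw [show 3 - α + 1 = 4 - α by ring] at g2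
    rw [show 4 - α + 1 = 5 - α by ring] at g3
    rw [g3, g2, g1]
  have hGpos : 0 < Real.Gamma (2 - α) := Real.Gamma_pos_of_pos (by linarith)
  have i4 : Integrable (fun y : ℝ => cexp (((1:ℝ):ℂ) + y * I) * ((((1:ℝ):ℂ) + y * I) ^ ((α - 5 : ℝ) : ℂ) * P3.eval 0)) := by
    have := ml_int_poly α hα1 hα2 x hx (α - 5) (by linarith) (Polynomial.C (P3.eval 0))
    simpa only [Polynomial.eval_C] using this
  have e4 : ∫ y : ℝ, cexp (((1:ℝ):ℂ) + y * I) * ((((1:ℝ):ℂ) + y * I) ^ ((α - 5 : ℝ) : ℂ) * P3.eval 0)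
      = ((-(2 * Real.pi / Real.Gamma (2 - α)) : ℝ) : ℂ) := by
    simp_rw [← mul_assoc]
    rw [integral_mul_const, hbr, hP30, hGam]
    rw [← Complex.ofReal_neg]
    have q2 : (2 - α) ≠ 0 := by linarith
    have q3 : (3 - α) ≠ 0 := by linarith
    have q4 : (4 - α) ≠ 0 := by linarith
    norm_cast
    field_simp
  have hdiff := integral_sub i3 i4
  rw [e4] at hdiff
  have hb : ‖∫ y : ℝ, (cexp (((1:ℝ):ℂ) + y * I) * ((((1:ℝ):ℂ) + y * I) ^ ((α - 5 : ℝ) : ℂ) * P3.eval (mlp α x (((1:ℝ):ℂ) + y * I)))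
      - cexp (((1:ℝ):ℂ) + y * I) * ((((1:ℝ):ℂ) + y * I) ^ ((α - 5 : ℝ) : ℂ) * P3.eval 0))‖ ≤ (Real.exp 1 * B * κ⁻¹ / x) * J := by
    rw [hJ, ← integral_const_mul]
    refine norm_integral_le_of_norm_le (hJi.const_mul _) (ae_of_all _ fun y => ?_)
    have hsne := ml_ne (hline y)
    have hs0 : 0 < ‖((1:ℝ):ℂ) + y * I‖ := norm_pos_iff.2 hsne
    obtain ⟨p1, p2⟩ := mlp_bd α κ x hκ hx _ hsne (hden _ (hline y) x hx)
    rw [← mul_sub, ← mul_sub, norm_mul, norm_mul, ml_exp_norm, Complex.norm_cpow_real]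
    calc Real.exp 1 * (‖((1:ℝ):ℂ) + y * I‖ ^ (α - 5) * ‖P3.eval (mlp α x (((1:ℝ):ℂ) + y * I)) - P3.eval 0‖)
        ≤ Real.exp 1 * (‖((1:ℝ):ℂ) + y * I‖ ^ (α - 5) * (B * (κ⁻¹ * ‖((1:ℝ):ℂ) + y * I‖ ^ α / x))) := by
          gcongr
          exact (hB _ p1).trans (by gcongr)
      _ = Real.exp 1 * B * κ⁻¹ / x * (‖((1:ℝ):ℂ) + y * I‖ ^ (α - 5) * ‖((1:ℝ):ℂ) + y * I‖ ^ α) := by ring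
      _ = _ := by
          rw [← Real.rpow_add hs0]
          congr 2; ring
  rw [hdiff] at hb
  set Q := ∫ y : ℝ, cexp (((1:ℝ):ℂ) + y * I) * ((((1:ℝ):ℂ) + y * I) ^ ((α - 5 : ℝ) : ℂ) * P3.eval (mlp α x (((1:ℝ):ℂ) + y * I))) with hQ
  have hQe : Q = ((-(x * (2 * Real.pi * mittagLeffler α 2 (-x))) : ℝ) : ℂ) := by
    push_cast
    linear_combination b1
  rw [hQe, ← Complex.ofReal_sub, Complex.norm_real, Real.norm_eq_abs] at hb
  have hfin : -(x * (2 * Real.pi * mittagLeffler α 2 (-x))) - -(2 * Real.pi / Real.Gamma (2 - α))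
      = -(2 * Real.pi * x) * (mittagLeffler α 2 (-x) - 1 / (Real.Gamma (2 - α) * x)) := by
    field_simp
    ring
  rw [hfin, abs_mul, abs_neg, abs_of_pos (by positivity)] at hb
  set A := |mittagLeffler α 2 (-x) - 1 / (Real.Gamma (2 - α) * x)| with hA
  have hA0 : 0 ≤ A := abs_nonneg _
  have hpi : 1 ≤ 2 * Real.pi := by linarith [Real.pi_gt_three]
  rw [le_div_iff₀ (by positivity)]
  have h1 : x * A ≤ Real.exp 1 * B * κ⁻¹ / x * J := by
    refine le_trans ?_ hb
    have : 0 ≤ x * A := by positivity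
    nlinarith
  have h2 : x * (x * A) ≤ x * (Real.exp 1 * B * κ⁻¹ / x * J) := by gcongr
  have h3 : x * (Real.exp 1 * B * κ⁻¹ / x * J) = Real.exp 1 * B * κ⁻¹ * J := by field_simp
  nlinarith

end
end

section
/- Let 1 < α < 2. Then the set { t ∈ ℝ : t ≥ 0 and E_{α,2}(−t) = 0 } of nonnegative real zeros of the function t ↦ E_{α,2}(−t) is finite. -/
open MeasureTheory Set Complex

open ProbabilityTheory in
theorem ML_laplace (b : ℝ) (hb : 0 < b) (s : ℂ) (hs : 0 < s.re) :
    ∫ x : ℝ in Ioi 0, ((x ^ (b - 1) : ℝ) : ℂ) * cexp (-(s * x)) = Real.Gamma b * s ^ (-(b : ℂ)) := by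
  set μ : Measure ℝ := (volume.restrict (Ioi (0:ℝ))).withDensity (fun x => ENNReal.ofReal (x ^ (b - 1))) with hμ
  set X : ℝ → ℝ := fun x => -x with hX
  have hmeas : Measurable (fun x : ℝ => x ^ (b - 1)) := by fun_prop
  have hrw : ∀ f : ℝ → ℂ, ∫ x, f x ∂μ = ∫ x : ℝ in Ioi 0, ((x ^ (b - 1) : ℝ) : ℂ) * f x := by
    intro f
    rw [hμ, integral_withDensity_eq_integral_toReal_smul (by fun_prop) (by simp)]
    refine setIntegral_congr_fun measurableSet_Ioi fun x hx => ?_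
    have hx' : (0:ℝ) < x := hx
    simp only [Complex.real_smul]
    rw [ENNReal.toReal_ofReal (by positivity)]
  have hset : Ioi (0:ℝ) ⊆ integrableExpSet X μ := by
    intro t ht
    have ht' : (0:ℝ) < t := ht
    change Integrable (fun x => Real.exp (t * X x)) μ
    rw [hμ, integrable_withDensity_iff_integrable_smul' (by fun_prop) (by simp)]
    have := integrableOn_rpow_mul_exp_neg_mul_rpow (p := 1) (s := b - 1) (b := t) (by linarith) one_pos ht'
    refine this.congr_fun (fun x hx => ?_) measurableSet_Ioi
    have hx' : (0:ℝ) < x := hx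
    simp only [smul_eq_mul, hX, Real.rpow_one]
    rw [ENNReal.toReal_ofReal (by positivity)]
    ring_nf
  have hint : Ioi (0:ℝ) ⊆ interior (integrableExpSet X μ) := interior_maximal hset isOpen_Ioi
  have hU : IsPreconnected {z : ℂ | 0 < z.re} := (convex_halfSpace_re_gt 0).isPreconnected
  have hA : AnalyticOnNhd ℂ (complexMGF X μ) {z : ℂ | 0 < z.re} :=
    (analyticOnNhd_complexMGF (X := X) (μ := μ)).mono (fun z hz => hint hz)
  have hB : AnalyticOnNhd ℂ (fun z : ℂ => Real.Gamma b * z ^ (-(b : ℂ))) {z : ℂ | 0 < z.re} := by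
    refine DifferentiableOn.analyticOnNhd ?_ (isOpen_lt continuous_const continuous_re)
    intro z hz
    refine DifferentiableAt.differentiableWithinAt ?_
    have : z ∈ slitPlane := Or.inl hz
    exact (differentiableAt_const _).mul (differentiableAt_id.cpow_const this)
  have hreal : ∀ r : ℝ, 0 < r → complexMGF X μ r = Real.Gamma b * (r:ℂ) ^ (-(b : ℂ)) := by
    intro r hr
    rw [complexMGF, hrw]
    have h := integral_cpow_mul_exp_neg_mul_Ioi (a := b) (r := r) (by simpa using hb) hr
    rw [Complex.Gamma_ofReal, one_div, Complex.inv_cpow _ _ (by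
      rw [Complex.arg_ofReal_of_nonneg hr.le]; exact Real.pi_pos.ne), ← Complex.cpow_neg, mul_comm] at h
    rw [← h]
    refine setIntegral_congr_fun measurableSet_Ioi fun x hx => ?_
    have hx' : (0:ℝ) < x := hx
    simp only [hX]
    rw [Complex.ofReal_cpow hx'.le]
    push_cast
    ring_nf
  have hfreq : ∃ᶠ z in nhdsWithin (1:ℂ) {1}ᶜ, complexMGF X μ z = Real.Gamma b * z ^ (-(b : ℂ)) := by
    have ht : Filter.Tendsto (fun r : ℝ => (r : ℂ)) (nhdsWithin (1:ℝ) {1}ᶜ) (nhdsWithin (1:ℂ) {1}ᶜ) := by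
      rw [tendsto_nhdsWithin_iff]
      constructor
      · have := (Complex.continuous_ofReal.tendsto (1:ℝ)).mono_left (nhdsWithin_le_nhds (s := {1}ᶜ))
        simpa using this
      · filter_upwards [self_mem_nhdsWithin] with r hr
        simpa using hr
    refine ht.frequently (p := fun z => complexMGF X μ z = Real.Gamma b * z ^ (-(b : ℂ))) ?_
    have : ∀ᶠ r : ℝ in nhdsWithin (1:ℝ) {1}ᶜ, 0 < r :=
      nhdsWithin_le_nhds (lt_mem_nhds one_pos)
    exact (this.mono fun r hr => hreal r hr).frequently
  have := hA.eqOn_of_preconnected_of_frequently_eq hB hU (by simp : (1:ℂ) ∈ {z : ℂ | 0 < z.re}) hfreq hs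
  simp only [complexMGF] at this
  rw [hrw] at this
  rw [← this]
  refine setIntegral_congr_fun measurableSet_Ioi fun x hx => ?_
  simp [hX]

theorem ML_integrable_cpow (b : ℝ) (hb : 1 < b) (A : ℝ) (hA : 0 < A) :
    Integrable (fun y : ℝ => ((A : ℂ) + y * I) ^ (-(b : ℂ))) := by
  have hm : 0 < min A 1 / 2 := by positivity
  have h1 : Integrable (fun y : ℝ => (min A 1 / 2) ^ (-b) * (1 + ‖y‖) ^ (-b)) :=
    (integrable_one_add_norm (by simpa using hb)).const_mul _
  refine h1.mono' ?_ ?_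
  · refine Continuous.aestronglyMeasurable ?_
    refine Continuous.cpow (by fun_prop) (by fun_prop) fun y => Or.inl ?_
    simpa using hA
  · refine Filter.Eventually.of_forall fun y => ?_
    rw [← Complex.ofReal_neg, Complex.norm_cpow_real, ← Real.mul_rpow hm.le (by positivity)]
    refine Real.rpow_le_rpow_of_nonpos (by positivity) ?_ (by linarith)
    have h2 : A ≤ ‖(A : ℂ) + y * I‖ := by
      have := Complex.re_le_norm ((A : ℂ) + y * I)
      simpa using this
    have h3 : |y| ≤ ‖(A : ℂ) + y * I‖ := by
      have := Complex.abs_im_le_norm ((A : ℂ) + y * I)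
      simpa using this
    have h4 : min A 1 ≤ A := min_le_left _ _
    have h5 : min A 1 ≤ 1 := min_le_right _ _
    rw [Real.norm_eq_abs]
    nlinarith [abs_nonneg y]

open scoped FourierTransform in
theorem ML_inversion (b : ℝ) (hb : 1 < b) (A : ℝ) (hA : 0 < A) (x : ℝ) (hx : 0 < x) :
    ∫ y : ℝ, cexp (((A : ℂ) + y * I) * x) * ((A : ℂ) + y * I) ^ (-(b : ℂ)) =
      ((2 * Real.pi * (x ^ (b - 1) / Real.Gamma b) : ℝ) : ℂ) := by
  have hG : 0 < Real.Gamma b := Real.Gamma_pos_of_pos (by linarith)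
  set f : ℝ → ℂ := (Ioi (0:ℝ)).indicator (fun x => ((x ^ (b - 1) * Real.exp (-A * x) : ℝ) : ℂ)) with hf
  have hfi : Integrable f := by
    rw [hf, integrable_indicator_iff measurableSet_Ioi]
    have := integrableOn_rpow_mul_exp_neg_mul_rpow (p := 1) (s := b - 1) (b := A) (by linarith) one_pos hA
    simp only [Real.rpow_one] at this
    exact this.ofReal
  have hF : 𝓕 f = fun w : ℝ => Real.Gamma b * ((A : ℂ) + (2 * Real.pi * w : ℝ) * I) ^ (-(b : ℂ)) := by
    funext w
    rw [Real.fourier_real_eq_integral_exp_smul, ← ML_laplace b (by linarith) _ (by simpa using hA),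
      ← integral_indicator measurableSet_Ioi]
    congr 1
    funext v
    by_cases hv : v ∈ Ioi (0:ℝ)
    · simp only [hf, indicator_of_mem hv, smul_eq_mul]
      push_cast
      rw [mul_left_comm, ← Complex.exp_add]
      congr 2
      ring
    · simp [hf, indicator_of_notMem hv]
  have hFi : Integrable (𝓕 f) := by
    rw [hF]
    refine Integrable.const_mul ?_ _
    exact (ML_integrable_cpow b hb A hA).comp_mul_left' (g := fun y : ℝ => ((A : ℂ) + y * I) ^ (-(b : ℂ))) (R := 2 * Real.pi) (by positivity)
  have hc : ContinuousAt f x := by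
    have : f =ᶠ[nhds x] (fun x => ((x ^ (b - 1) * Real.exp (-A * x) : ℝ) : ℂ)) := by
      filter_upwards [Ioi_mem_nhds hx] with v hv
      simp [hf, indicator_of_mem hv]
    refine ContinuousAt.congr ?_ this.symm
    refine Complex.continuous_ofReal.continuousAt.comp ?_
    exact (Real.continuousAt_rpow_const _ _ (Or.inl hx.ne')).mul (by fun_prop)
  have h := hfi.fourierInv_fourier_eq hFi hc
  rw [Real.fourierInv_eq', hF] at h
  have hfx : f x = ((x ^ (b - 1) * Real.exp (-A * x) : ℝ) : ℂ) := by
    simp [hf, indicator_of_mem (show x ∈ Ioi (0:ℝ) from hx)]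
  rw [hfx] at h
  have h2 := Measure.integral_comp_mul_left (fun y : ℝ => cexp (((A : ℂ) + y * I) * x) * ((A : ℂ) + y * I) ^ (-(b : ℂ))) (2 * Real.pi)
  have h3 : ∫ w : ℝ, cexp (((A : ℂ) + (2 * Real.pi * w : ℝ) * I) * x) * ((A : ℂ) + (2 * Real.pi * w : ℝ) * I) ^ (-(b : ℂ)) 
      = (cexp (A * x) / Real.Gamma b) * ((x ^ (b - 1) * Real.exp (-A * x) : ℝ) : ℂ) := by
    rw [← h, ← integral_const_mul]
    congr 1
    funext w
    have hG' : (Real.Gamma b : ℂ) ≠ 0 := by exact_mod_cast hG.ne'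
    rw [add_mul, Complex.exp_add]
    simp only [smul_eq_mul, RCLike.inner_apply, conj_trivial]
    have e : cexp (((2 * Real.pi * w : ℝ) : ℂ) * I * x) = cexp (((2 * Real.pi * (x * w) : ℝ) : ℂ) * I) := by
      congr 1
      push_cast
      ring
    rw [e]
    field_simp
  rw [h3, abs_of_pos (by positivity), Complex.real_smul] at h2
  have h4 : ∫ y : ℝ, cexp (((A : ℂ) + y * I) * x) * ((A : ℂ) + y * I) ^ (-(b : ℂ)) = 
     (2 * Real.pi : ℝ) * ((cexp (A * x) / Real.Gamma b) * ((x ^ (b - 1) * Real.exp (-A * x) : ℝ) : ℂ)) := by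
    rw [h2, ← mul_assoc, ← Complex.ofReal_mul, mul_inv_cancel₀ (by positivity)]
    simp
  rw [h4]
  have h5 : cexp (A * x) = (Real.exp (A * x) : ℝ) := by push_cast; rfl
  rw [h5]
  norm_cast
  rw [neg_mul, Real.exp_neg]
  field_simp


noncomputable def ML_H (α : ℝ) (s : ℂ) : ℂ :=
  s ^ ((α - 3 : ℝ) : ℂ) * (((2 - α : ℝ) : ℂ) + ((2 - 2 * α : ℝ) : ℂ) * s ^ ((-α : ℝ) : ℂ)) / (1 + s ^ ((-α : ℝ) : ℂ)) ^ 2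

theorem ML_one_add (α : ℝ) (h1 : 1 < α) (h2 : α < 2) (s : ℂ) (hs : 0 < s.re) :
    Real.cos (α * Real.pi / 4) * (1 + ‖s‖ ^ (-α)) ≤ ‖1 + s ^ ((-α : ℝ) : ℂ)‖ := by
  have hs0 : s ≠ 0 := by rintro rfl; simp at hs
  have harg : |s.arg| ≤ Real.pi / 2 := (Complex.abs_arg_le_pi_div_two_iff).2 hs.le
  set ρ := ‖s‖ ^ (-α) with hρ
  have hρ0 : 0 < ρ := by positivity
  have hpi := Real.pi_pos
  set φ := s.arg * (-α) with hφ
  have hz : s ^ ((-α : ℝ) : ℂ) = ρ * (Real.cos φ + Real.sin φ * I) := by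
    rw [Complex.cpow_ofReal]
  have hcosnn : 0 ≤ Real.cos (α * Real.pi / 4) := Real.cos_nonneg_of_mem_Icc ⟨by nlinarith, by nlinarith⟩
  have hcos : Real.cos (α * Real.pi / 2) ≤ Real.cos φ := by
    rw [← Real.cos_abs φ]
    refine Real.cos_le_cos_of_nonneg_of_le_pi (abs_nonneg _) (by nlinarith) ?_
    rw [hφ, abs_mul, abs_neg, abs_of_pos (by linarith : 0 < α)]
    nlinarith
  have hdbl : Real.cos (α * Real.pi / 2) = 2 * Real.cos (α * Real.pi / 4) ^ 2 - 1 := by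
    rw [← Real.cos_two_mul]; ring_nf
  refine abs_le_of_sq_le_sq' ?_ (norm_nonneg _) |>.2
  rw [← Complex.normSq_eq_norm_sq, hz, Complex.normSq_apply]
  simp [-Complex.ofReal_cos, -Complex.ofReal_sin]
  have hsc := Real.sin_sq_add_cos_sq φ
  have hc1 : Real.cos (α * Real.pi / 4) ^ 2 ≤ 1 := Real.cos_sq_le_one _
  set κ := Real.cos (α * Real.pi / 4)
  have e : (1 + ρ * Real.cos φ) * (1 + ρ * Real.cos φ) + ρ * Real.sin φ * (ρ * Real.sin φ) = 1 + 2 * ρ * Real.cos φ + ρ ^ 2 := by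
    linear_combination ρ ^ 2 * hsc
  rw [e]
  have e2 : 2 * ρ * (2 * κ ^ 2 - 1) ≤ 2 * ρ * Real.cos φ := by
    refine mul_le_mul_of_nonneg_left ?_ (by positivity); linarith
  nlinarith [sq_nonneg (1 - ρ)]

theorem ML_kappa (α : ℝ) (h1 : 1 < α) (h2 : α < 2) : 0 < Real.cos (α * Real.pi / 4) := by
  have hpi := Real.pi_pos
  exact Real.cos_pos_of_mem_Ioo ⟨by nlinarith, by nlinarith⟩

theorem ML_one_add_ne (α : ℝ) (h1 : 1 < α) (h2 : α < 2) (s : ℂ) (hs : 0 < s.re) :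
    1 + s ^ ((-α : ℝ) : ℂ) ≠ 0 := by
  have := ML_one_add α h1 h2 s hs
  have hk := ML_kappa α h1 h2
  have : 0 < ‖1 + s ^ ((-α : ℝ) : ℂ)‖ := lt_of_lt_of_le (by positivity) this
  exact norm_pos_iff.1 this

theorem ML_H_diff (α : ℝ) (h1 : 1 < α) (h2 : α < 2) (s : ℂ) (hs : 0 < s.re) :
    DifferentiableAt ℂ (ML_H α) s := by
  have hsl : s ∈ slitPlane := Or.inl hs
  have hp : ∀ c : ℂ, DifferentiableAt ℂ (fun s : ℂ => s ^ c) s := fun c =>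
    differentiableAt_id.cpow_const hsl
  unfold ML_H
  refine DifferentiableAt.div ?_ ?_ (pow_ne_zero _ (ML_one_add_ne α h1 h2 s hs))
  · exact (hp _).mul ((differentiableAt_const _).add ((differentiableAt_const _).mul (hp _)))
  · exact ((differentiableAt_const _).add (hp _)).pow 2

theorem ML_H_bound (α : ℝ) (h1 : 1 < α) (h2 : α < 2) (s : ℂ) (hs : 0 < s.re) :
    ‖ML_H α s‖ ≤ (2 / Real.cos (α * Real.pi / 4) ^ 2) * (‖s‖ ^ (α - 3) / (1 + ‖s‖ ^ (-α))) := by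
  have hk := ML_kappa α h1 h2
  have h := ML_one_add α h1 h2 s hs
  have hs0 : s ≠ 0 := by rintro rfl; simp at hs
  set κ := Real.cos (α * Real.pi / 4)
  have hn : 0 < ‖s‖ := norm_pos_iff.2 hs0
  unfold ML_H
  rw [norm_div, norm_mul, norm_pow, Complex.norm_cpow_real]
  have hnum : ‖((2 - α : ℝ) : ℂ) + ((2 - 2 * α : ℝ) : ℂ) * s ^ ((-α : ℝ) : ℂ)‖ ≤ 2 * (1 + ‖s‖ ^ (-α)) := by
    refine (norm_add_le _ _).trans ?_
    rw [norm_mul, Complex.norm_cpow_real, Complex.norm_real, Complex.norm_real, Real.norm_eq_abs, Real.norm_eq_abs,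
      abs_of_pos (by linarith), abs_of_neg (by linarith)]
    have : 0 < ‖s‖ ^ (-α) := by positivity
    nlinarith
  calc _ ≤ ‖s‖ ^ (α - 3) * (2 * (1 + ‖s‖ ^ (-α))) / (κ * (1 + ‖s‖ ^ (-α))) ^ 2 := by
        gcongr
    _ = _ := by
        have : 0 < 1 + ‖s‖ ^ (-α) := by positivity
        field_simp

noncomputable def ML_G (α : ℝ) (y : ℝ) : ℝ := if y ≤ 1 then y ^ (α - 2) else y ^ (α - 3)

theorem ML_G_int (α : ℝ) (h1 : 1 < α) (h2 : α < 2) : Integrable (fun y : ℝ => ML_G α |y|) := by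
  have hI : IntegrableOn (ML_G α) (Ioi 0) := by
    rw [← Ioc_union_Ioi_eq_Ioi (zero_le_one' ℝ), integrableOn_union]
    constructor
    · have : IntegrableOn (fun y : ℝ => y ^ (α - 2)) (Ioc 0 1) := by
        rw [← intervalIntegrable_iff_integrableOn_Ioc_of_le zero_le_one]
        exact intervalIntegral.intervalIntegrable_rpow' (by linarith)
      refine this.congr_fun (fun y hy => ?_) measurableSet_Ioc
      simp [ML_G, hy.2]
    · have : IntegrableOn (fun y : ℝ => y ^ (α - 3)) (Ioi 1) :=
        integrableOn_Ioi_rpow_of_lt (by linarith) one_pos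
      refine this.congr_fun (fun y hy => ?_) measurableSet_Ioi
      have : ¬ y ≤ 1 := not_le.2 hy
      simp [ML_G, this]
  have hp : IntegrableOn (fun y : ℝ => ML_G α |y|) (Ioi 0) := by
    refine hI.congr_fun (fun y hy => ?_) measurableSet_Ioi
    simp only [abs_of_pos (show (0:ℝ) < y from hy)]
  rw [← integrableOn_univ, ← Iic_union_Ioi (a := (0:ℝ)), integrableOn_union]
  refine ⟨?_, hp⟩
  have h := (Measure.measurePreserving_neg (volume : Measure ℝ)).integrableOn_comp_preimage
      (Homeomorph.neg ℝ).measurableEmbedding (f := fun y : ℝ => ML_G α |y|) (s := Ioi 0)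
  have h' := h.2 hp
  rw [integrableOn_Iic_iff_integrableOn_Iio]
  convert! h' using 1
  · funext y; simp
  · ext y; simp

theorem ML_H_bound' (α : ℝ) (h1 : 1 < α) (h2 : α < 2) (s : ℂ) (hs : 0 < s.re) (hy : s.im ≠ 0) :
    ‖ML_H α s‖ ≤ (2 / Real.cos (α * Real.pi / 4) ^ 2) * ML_G α |s.im| := by
  refine (ML_H_bound α h1 h2 s hs).trans ?_
  refine mul_le_mul_of_nonneg_left ?_ (by positivity)
  have hy' : 0 < |s.im| := abs_pos.2 hy
  have hle := Complex.abs_im_le_norm s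
  have hn : 0 < ‖s‖ := hy'.trans_le hle
  have hp : 0 < ‖s‖ ^ (-α) := by positivity
  unfold ML_G
  split_ifs with h
  · refine le_trans ?_ (Real.rpow_le_rpow_of_nonpos hy' hle (by linarith))
    rw [div_le_iff₀ (by positivity), mul_add, mul_one, ← Real.rpow_add hn]
    rcases le_total 1 ‖s‖ with h' | h'
    · have : ‖s‖ ^ (α - 3) ≤ ‖s‖ ^ (α - 2) := Real.rpow_le_rpow_of_exponent_le h' (by linarith)
      have : 0 < ‖s‖ ^ (α - 2 + -α) := by positivity
      linarith
    · have : ‖s‖ ^ (α - 3) ≤ ‖s‖ ^ (α - 2 + -α) := Real.rpow_le_rpow_of_exponent_ge hn h' (by linarith)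
      have : 0 < ‖s‖ ^ (α - 2) := by positivity
      linarith
  · refine le_trans ?_ (Real.rpow_le_rpow_of_nonpos hy' hle (by linarith))
    rw [div_le_iff₀ (by positivity)]
    have : 0 < ‖s‖ ^ (α - 3) := by positivity
    nlinarith

theorem ML_ae_ne : ∀ᵐ y : ℝ, y ≠ 0 := by
  have : (volume : Measure ℝ) {0} = 0 := by simp
  exact compl_mem_ae_iff.2 this

theorem ML_F_ae (α : ℝ) (h1 : 1 < α) (h2 : α < 2) (x A : ℝ) (hA : 0 < A) :
    ∀ᵐ y : ℝ, ‖cexp (((A : ℂ) + y * I) * x) * ML_H α ((A : ℂ) + y * I)‖ ≤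
      Real.exp (A * x) * ((2 / Real.cos (α * Real.pi / 4) ^ 2) * ML_G α |y|) := by
  filter_upwards [ML_ae_ne] with y hy
  rw [norm_mul, Complex.norm_exp]
  have e : (((A : ℂ) + y * I) * x).re = A * x := by simp
  rw [e]
  refine mul_le_mul_of_nonneg_left ?_ (Real.exp_pos _).le
  have := ML_H_bound' α h1 h2 ((A : ℂ) + y * I) (by simpa using hA) (by simpa using hy)
  simpa using this

theorem ML_F_int (α : ℝ) (h1 : 1 < α) (h2 : α < 2) (x A : ℝ) (hA : 0 < A) :
    Integrable (fun y : ℝ => cexp (((A : ℂ) + y * I) * x) * ML_H α ((A : ℂ) + y * I)) := by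
  refine (((ML_G_int α h1 h2).const_mul _).const_mul _).mono' ?_ (ML_F_ae α h1 h2 x A hA)
  refine Continuous.aestronglyMeasurable ?_
  refine Continuous.mul (by fun_prop) ?_
  rw [continuous_iff_continuousAt]
  intro y
  have h := (ML_H_diff α h1 h2 ((A : ℂ) + y * I) (by simpa using hA)).continuousAt
  exact ContinuousAt.comp (f := fun y : ℝ => (A : ℂ) + y * I) h (by fun_prop)

theorem ML_shift (α : ℝ) (h1 : 1 < α) (h2 : α < 2) (x : ℝ) (hx : 0 < x) (ε : ℝ) (hε : 0 < ε) (hε2 : ε < 2) :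
    ∫ y : ℝ, cexp ((((2:ℝ) : ℂ) + y * I) * x) * ML_H α (((2:ℝ) : ℂ) + y * I) =
    ∫ y : ℝ, cexp (((ε : ℂ) + y * I) * x) * ML_H α ((ε : ℂ) + y * I) := by
  set F : ℂ → ℂ := fun s => cexp (s * x) * ML_H α s with hF
  set K := 2 / Real.cos (α * Real.pi / 4) ^ 2 with hK
  have hK0 : 0 ≤ K := by positivity
  have hrect : ∀ T : ℝ, (∫ u : ℝ in ε..2, F (u + (-T : ℝ) * I)) - (∫ u : ℝ in ε..2, F (u + T * I)) +
      I • (∫ y : ℝ in (-T)..T, F ((2:ℝ) + y * I)) - I • (∫ y : ℝ in (-T)..T, F (ε + y * I)) = 0 := by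
    intro T
    have := Complex.integral_boundary_rect_eq_zero_of_differentiableOn F ⟨ε, -T⟩ ⟨2, T⟩ ?_
    · simpa using this
    · intro s hs
      refine DifferentiableAt.differentiableWithinAt ?_
      have hs' : s.re ∈ Set.uIcc ε 2 := hs.1
      rw [uIcc_of_le hε2.le] at hs'
      exact DifferentiableAt.mul (by fun_prop) (ML_H_diff α h1 h2 s (hε.trans_le hs'.1))
  have hhor : ∀ T : ℝ, 1 < |T| → ‖∫ u : ℝ in ε..2, F (u + T * I)‖ ≤ Real.exp (2 * x) * (K * |T| ^ (α - 3)) * |2 - ε| := by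
    intro T hT
    refine intervalIntegral.norm_integral_le_of_norm_le_const fun u hu => ?_
    rw [uIoc_of_le hε2.le] at hu
    simp only [hF]
    rw [norm_mul, Complex.norm_exp]
    have e : (((u : ℂ) + T * I) * x).re = u * x := by simp
    rw [e]
    have hT0 : T ≠ 0 := by rintro rfl; simp at hT; linarith
    have hb := ML_H_bound' α h1 h2 ((u : ℂ) + T * I) (by simpa using hε.trans hu.1) (by simpa using hT0)
    have hG : ML_G α |T| = |T| ^ (α - 3) := by simp [ML_G, not_le.2 hT]
    simp only [add_im, ofReal_im, mul_im, ofReal_re, I_im, mul_one, I_re, mul_zero, add_zero, zero_add, hG] at hb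
    refine mul_le_mul ?_ hb (norm_nonneg _) (Real.exp_pos _).le
    exact Real.exp_le_exp.2 (mul_le_mul_of_nonneg_right hu.2 hx.le)
  have hlim0 : Filter.Tendsto (fun T : ℝ => Real.exp (2 * x) * (K * |T| ^ (α - 3)) * |2 - ε|) Filter.atTop (nhds 0) := by
    have h3 : Filter.Tendsto (fun T : ℝ => |T| ^ (α - 3)) Filter.atTop (nhds 0) := by
      have := (tendsto_rpow_neg_atTop (show 0 < 3 - α by linarith)).comp (Filter.tendsto_abs_atTop_atTop (G := ℝ))
      simpa [Function.comp_def] using this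
    simpa using ((h3.const_mul K).const_mul (Real.exp (2 * x))).mul_const |2 - ε|
  have hup : Filter.Tendsto (fun T : ℝ => ∫ u : ℝ in ε..2, F (u + T * I)) Filter.atTop (nhds 0) := by
    refine squeeze_zero_norm' ?_ hlim0
    filter_upwards [Filter.eventually_gt_atTop 1] with T hT
    exact hhor T (lt_of_lt_of_le hT (le_abs_self T))
  have hdn : Filter.Tendsto (fun T : ℝ => ∫ u : ℝ in ε..2, F (u + (-T : ℝ) * I)) Filter.atTop (nhds 0) := by
    refine squeeze_zero_norm' ?_ hlim0
    filter_upwards [Filter.eventually_gt_atTop 1] with T hT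
    have := hhor (-T) (by rw [abs_neg]; exact lt_of_lt_of_le hT (le_abs_self T))
    rwa [abs_neg] at this
  have hv : ∀ A : ℝ, 0 < A → Filter.Tendsto (fun T : ℝ => ∫ y : ℝ in (-T)..T, F (A + y * I)) Filter.atTop (nhds (∫ y : ℝ, F (A + y * I))) := by
    intro A hA
    exact intervalIntegral_tendsto_integral (ML_F_int α h1 h2 x A hA) Filter.tendsto_neg_atTop_atBot Filter.tendsto_id
  have hlim := ((hdn.sub hup).add ((hv 2 two_pos).const_smul I)).sub ((hv ε hε).const_smul I)
  have := tendsto_nhds_unique hlim (by simp only [hrect]; exact tendsto_const_nhds)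
  rw [sub_zero, zero_add, ← smul_sub, smul_eq_zero] at this
  rcases this with h | h
  · exact absurd h I_ne_zero
  · exact sub_eq_zero.1 h

theorem ML_bounded (α : ℝ) (h1 : 1 < α) (h2 : α < 2) : ∃ C : ℝ, ∀ x : ℝ, 0 < x →
    ‖∫ y : ℝ, cexp ((((2:ℝ) : ℂ) + y * I) * x) * ML_H α (((2:ℝ) : ℂ) + y * I)‖ ≤ C := by
  refine ⟨∫ y : ℝ, (2 / Real.cos (α * Real.pi / 4) ^ 2) * ML_G α |y|, fun x hx => ?_⟩
  set C := ∫ y : ℝ, (2 / Real.cos (α * Real.pi / 4) ^ 2) * ML_G α |y| with hC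
  have hb : ∀ ε : ℝ, 0 < ε → ε < 2 → 
    ‖∫ y : ℝ, cexp ((((2:ℝ) : ℂ) + y * I) * x) * ML_H α (((2:ℝ) : ℂ) + y * I)‖ ≤ Real.exp (ε * x) * C := by
    intro ε hε hε2
    rw [ML_shift α h1 h2 x hx ε hε hε2, hC, ← integral_const_mul]
    exact norm_integral_le_of_norm_le (((ML_G_int α h1 h2).const_mul _).const_mul _) (ML_F_ae α h1 h2 x ε hε)
  have hlim : Filter.Tendsto (fun ε : ℝ => Real.exp (ε * x) * C) (nhdsWithin 0 (Ioi 0)) (nhds C) := by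
    have : Continuous (fun ε : ℝ => Real.exp (ε * x) * C) := by fun_prop
    have := this.tendsto 0
    simp only [zero_mul, Real.exp_zero, one_mul] at this
    exact this.mono_left nhdsWithin_le_nhds
  refine ge_of_tendsto hlim ?_
  filter_upwards [Ioo_mem_nhdsGT (show (0:ℝ) < 2 by norm_num)] with ε hε
  exact hb ε hε.1 hε.2

theorem ML_term_cpow (α : ℝ) (j : ℕ) (s : ℂ) (hs : s ≠ 0) :
    s ^ (-((α * j + 3 - α : ℝ) : ℂ)) = s ^ ((α - 3 : ℝ) : ℂ) * (s ^ ((-α : ℝ) : ℂ)) ^ j := by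
  rw [← Complex.cpow_nat_mul, ← Complex.cpow_add _ _ hs]
  congr 1
  push_cast
  ring

theorem ML_H_hasSum (α : ℝ) (h1 : 1 < α) (h2 : α < 2) (s : ℂ) (hs : 1 < s.re) :
    HasSum (fun j : ℕ => (((-1) ^ j * (α * j + 2 - α) : ℝ) : ℂ) * s ^ (-((α * j + 3 - α : ℝ) : ℂ))) (ML_H α s) := by
  have hs0 : s ≠ 0 := by rintro rfl; simp at hs; linarith
  have hne := ML_one_add_ne α h1 h2 s (by linarith)
  set z := s ^ ((-α : ℝ) : ℂ) with hz
  have hn : ‖-z‖ < 1 := by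
    rw [norm_neg, hz, Complex.norm_cpow_real]
    refine Real.rpow_lt_one_of_one_lt_of_neg ?_ (by linarith)
    exact hs.trans_le (Complex.re_le_norm s)
  have hA := (hasSum_coe_mul_geometric_of_norm_lt_one hn).mul_left (α : ℂ)
  have hB := (hasSum_geometric_of_norm_lt_one hn).mul_left ((2 - α : ℝ) : ℂ)
  have hC := (hA.add hB).mul_left (s ^ ((α - 3 : ℝ) : ℂ))
  convert! hC using 1
  · funext j
    rw [ML_term_cpow α j s hs0, ← hz, neg_pow z]
    push_cast
    ring
  · unfold ML_H
    rw [← hz, sub_neg_eq_add]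
    field_simp
    push_cast
    ring

theorem ML_hasSum_integral (α : ℝ) (h1 : 1 < α) (h2 : α < 2) (x : ℝ) (hx : 0 < x) :
    HasSum (fun j : ℕ => ((2 * Real.pi * ((-1) ^ j * (x ^ (α * j + 2 - α) / Real.Gamma (α * j + 2 - α))) : ℝ) : ℂ))
     (∫ y : ℝ, cexp ((((2:ℝ) : ℂ) + y * I) * x) * ML_H α (((2:ℝ) : ℂ) + y * I)) := by
  set s : ℝ → ℂ := fun y => ((2:ℝ) : ℂ) + y * I with hs
  have hsre : ∀ y, (s y).re = 2 := by intro y; simp [hs]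
  have hs0 : ∀ y, s y ≠ 0 := by intro y h; have := hsre y; rw [h] at this; simp at this
  have hn2 : ∀ y, 2 ≤ ‖s y‖ := by
    intro y
    have := Complex.re_le_norm (s y)
    rwa [hsre] at this
  have hb : ∀ j : ℕ, 1 < α * j + 3 - α := by
    intro j
    have : 0 ≤ α * j := by positivity
    linarith
  set F : ℕ → ℝ → ℂ := fun j y => (((-1) ^ j * (α * j + 2 - α) : ℝ) : ℂ) * (cexp (s y * x) * s y ^ (-((α * j + 3 - α : ℝ) : ℂ))) with hF
  have hexp : ∀ y, ‖cexp (s y * x)‖ = Real.exp (2 * x) := by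
    intro y
    rw [Complex.norm_exp]
    simp [hs]
  have hFi : ∀ j, Integrable (F j) := by
    intro j
    refine Integrable.const_mul ?_ _
    refine (ML_integrable_cpow _ (hb j) 2 two_pos).bdd_mul (c := Real.exp (2 * x)) ?_ ?_
    · exact Continuous.aestronglyMeasurable (by fun_prop)
    · exact Filter.Eventually.of_forall fun y => (hexp y).le
  have hB : Integrable (fun y => ‖s y ^ (-((3 - α : ℝ) : ℂ))‖) := (ML_integrable_cpow (3 - α) (by linarith) 2 two_pos).norm
  set r : ℝ := (2:ℝ) ^ (-α) with hr
  have hr0 : 0 < r := by positivity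
  have hr1 : r < 1 := Real.rpow_lt_one_of_one_lt_of_neg (by norm_num) (by linarith)
  have hFn : ∀ j y, ‖F j y‖ ≤ (α * j + 2 - α) * r ^ j * (Real.exp (2 * x) * ‖s y ^ (-((3 - α : ℝ) : ℂ))‖) := by
    intro j y
    have hc : 0 < α * j + 2 - α := by linarith [hb j]
    simp only [hF]
    rw [norm_mul, norm_mul, hexp, ML_term_cpow α j _ (hs0 y), norm_mul, norm_pow, Complex.norm_cpow_real _ (-α), Complex.norm_real,
      norm_mul, norm_pow, norm_neg, norm_one, one_pow, one_mul, Real.norm_of_nonneg hc.le]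
    have e : (-((3 - α : ℝ) : ℂ)) = ((α - 3 : ℝ) : ℂ) := by push_cast; ring
    rw [e]
    have hle : ‖s y‖ ^ (-α) ≤ r := Real.rpow_le_rpow_of_nonpos two_pos (hn2 y) (by linarith)
    have hle2 : (‖s y‖ ^ (-α)) ^ j ≤ r ^ j := pow_le_pow_left₀ (by positivity) hle j
    calc _ = (α * j + 2 - α) * (‖s y‖ ^ (-α)) ^ j * (Real.exp (2 * x) * ‖s y ^ ((α - 3 : ℝ) : ℂ)‖) := by ring
      _ ≤ _ := by gcongr
  have hsum : Summable (fun j => ∫ y, ‖F j y‖) := by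
    have hS : Summable (fun j : ℕ => (α * j + 2 - α) * r ^ j * ∫ y, (Real.exp (2 * x) * ‖s y ^ (-((3 - α : ℝ) : ℂ))‖)) := by
      refine Summable.mul_right _ ?_
      have hrn : ‖r‖ < 1 := by rwa [Real.norm_of_nonneg hr0.le]
      have := ((hasSum_coe_mul_geometric_of_norm_lt_one hrn).summable.mul_left α).add ((summable_geometric_of_lt_one hr0.le hr1).mul_left (2 - α))
      refine this.congr fun j => ?_
      ring
    refine hS.of_nonneg_of_le (fun j => integral_nonneg fun y => norm_nonneg _) fun j => ?_
    rw [← integral_const_mul]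
    exact integral_mono (hFi j).norm ((hB.const_mul _).const_mul _) (hFn j)
  have h := hasSum_integral_of_summable_integral_norm hFi hsum
  convert! h using 1
  · funext j
    simp only [hF]
    rw [integral_const_mul, ML_inversion _ (hb j) 2 two_pos x hx, ← Complex.ofReal_mul]
    have hc : 0 < α * j + 2 - α := by linarith [hb j]
    have e1 : α * j + 3 - α = (α * j + 2 - α) + 1 := by ring
    have hG := Real.Gamma_pos_of_pos hc
    rw [e1, Real.Gamma_add_one hc.ne', add_sub_cancel_right]
    congr 1
    field_simp
  · congr 1
    funext y
    have := (ML_H_hasSum α h1 h2 (s y) (by rw [hsre]; norm_num)).mul_left (cexp (s y * x))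
    rw [← this.tsum_eq]
    congr 1
    funext j
    simp only [hF]
    ring

theorem ML_key (α : ℝ) (h1 : 1 < α) (h2 : α < 2) : ∃ C : ℝ, ∀ x : ℝ, 0 < x →
    (Summable fun k : ℕ => (-(x ^ α)) ^ k / Real.Gamma (α * k + 2)) ∧
    |x ^ (2 - α) / Real.Gamma (2 - α) - x ^ 2 * mittagLeffler α 2 (-(x ^ α))| ≤ C := by
  obtain ⟨C, hC⟩ := ML_bounded α h1 h2
  refine ⟨C / (2 * Real.pi), fun x hx => ?_⟩
  have hpi := Real.pi_pos
  have h := ML_hasSum_integral α h1 h2 x hx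
  set J := ∫ y : ℝ, cexp ((((2:ℝ) : ℂ) + y * I) * x) * ML_H α (((2:ℝ) : ℂ) + y * I)
  have hre := Complex.hasSum_re h
  simp only [Complex.ofReal_re] at hre
  have hre2 := hre.mul_left (2 * Real.pi)⁻¹
  have hterm : ∀ k : ℕ, (2 * Real.pi)⁻¹ * (2 * Real.pi * ((-1) ^ (k + 1) * (x ^ (α * ((k + 1 : ℕ) : ℝ) + 2 - α) / Real.Gamma (α * ((k + 1 : ℕ) : ℝ) + 2 - α))))
      = (-x ^ 2) * ((-(x ^ α)) ^ k / Real.Gamma (α * k + 2)) := by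
    intro k
    have e : α * ((k + 1 : ℕ) : ℝ) + 2 - α = α * k + 2 := by push_cast; ring
    rw [e, Real.rpow_add hx, Real.rpow_mul hx.le, Real.rpow_natCast, Real.rpow_two, neg_pow (x ^ α)]
    field_simp
    ring
  have hshift := (hasSum_nat_add_iff' 1).2 hre2
  simp only [hterm, Finset.sum_range_one] at hshift
  have hx2 : -x ^ 2 ≠ 0 := by simp [hx.ne']
  have hsummable : Summable fun k : ℕ => (-(x ^ α)) ^ k / Real.Gamma (α * k + 2) := by
    have := hshift.summable
    rwa [summable_mul_left_iff hx2] at this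
  refine ⟨hsummable, ?_⟩
  have hval := hshift.tsum_eq
  rw [tsum_mul_left] at hval
  have hval' : -x ^ 2 * mittagLeffler α 2 (-(x ^ α)) = (2 * Real.pi)⁻¹ * J.re - x ^ (2 - α) / Real.Gamma (2 - α) := by
    unfold mittagLeffler
    rw [hval]
    congr 1
    simp only [pow_zero, Nat.cast_zero, mul_zero, zero_add, one_mul]
    field_simp
  have e2 : x ^ (2 - α) / Real.Gamma (2 - α) - x ^ 2 * mittagLeffler α 2 (-(x ^ α)) = (2 * Real.pi)⁻¹ * J.re := by
    linarith
  rw [e2, abs_mul, abs_of_pos (by positivity), inv_mul_eq_div]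
  gcongr
  exact (Complex.abs_re_le_norm J).trans (hC x hx)

theorem ML_analytic (α : ℝ) (h1 : 1 < α) (h2 : α < 2) : AnalyticOnNhd ℝ (fun t => mittagLeffler α 2 (-t)) univ := by
  obtain ⟨C, hC⟩ := ML_key α h1 h2
  set a : ℕ → ℝ := fun k => (Real.Gamma (α * k + 2))⁻¹ with ha
  have hrad : (FormalMultilinearSeries.ofScalars ℝ a).radius = ⊤ := by
    rw [eq_top_iff]
    refine ENNReal.le_of_forall_nnreal_lt fun r _ => ?_
    have hr' : (r : ℝ) < r + 1 := by linarith
    have hs := (hC (((r:ℝ) + 1) ^ (1 / α)) (by positivity)).1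
    have e : (((r:ℝ) + 1) ^ (1 / α)) ^ α = (r:ℝ) + 1 := by
      rw [← Real.rpow_mul (by positivity)]
      have : 1 / α * α = 1 := by field_simp
      rw [this, Real.rpow_one]
    rw [e] at hs
    have hle : ((r + 1 : NNReal) : ENNReal) ≤ (FormalMultilinearSeries.ofScalars ℝ a).radius := by
      refine FormalMultilinearSeries.le_radius_of_tendsto (l := 0) _ ?_
      have := hs.tendsto_atTop_zero.norm
      rw [norm_zero] at this
      refine this.congr fun k => ?_
      rw [FormalMultilinearSeries.ofScalars_norm, norm_div, norm_pow, norm_neg, ha, norm_inv,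
        Real.norm_of_nonneg (by positivity)]
      push_cast
      rw [div_eq_mul_inv, mul_comm]
    refine le_trans ?_ hle
    exact_mod_cast hr'.le
  have hfp := (FormalMultilinearSeries.ofScalars ℝ a).hasFPowerSeriesOnBall (by rw [hrad]; exact ENNReal.zero_lt_top)
  have hsumeq : (FormalMultilinearSeries.ofScalars ℝ a).sum = mittagLeffler α 2 := by
    funext t
    refine (FormalMultilinearSeries.ofScalars_sum_eq a t).trans ?_
    unfold mittagLeffler
    congr 1
    funext k
    simp only [ha, smul_eq_mul]
    rw [div_eq_mul_inv, mul_comm]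
  rw [hrad, hsumeq] at hfp
  have hE : AnalyticOnNhd ℝ (mittagLeffler α 2) univ := by
    intro t _
    exact hfp.analyticAt_of_mem (by simp)
  intro t _
  exact (hE (-t) trivial).comp (f := fun t : ℝ => -t) (by fun_prop)

/-- for `1 < α < 2`, the set of nonnegative real zeros of
`t ↦ E_{α,2}(−t)` is finite. -/
theorem mittagLeffler_zeros_finite (α : ℝ) (hα1 : 1 < α) (hα2 : α < 2) :
    {t : ℝ | 0 ≤ t ∧ mittagLeffler α 2 (-t) = 0}.Finite := by
  obtain ⟨C, hC⟩ := ML_key α hα1 hα2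
  have hA := ML_analytic α hα1 hα2
  have hG : 0 < Real.Gamma (2 - α) := Real.Gamma_pos_of_pos (by linarith)
  have h0 : mittagLeffler α 2 (-0) ≠ 0 := by
    unfold mittagLeffler
    rw [tsum_eq_single 0]
    · simp
    · intro k hk
      simp [hk]
  have hcod := hA.preimage_zero_mem_codiscreteWithin (x := 0) h0 trivial isConnected_univ
  set M : ℝ := ((C * Real.Gamma (2 - α)) ^ (2 - α)⁻¹) ^ α with hM
  have hfin := (isCompact_Icc (a := (0:ℝ)) (b := M)).finite_sdiff_of_mem_codiscreteWithin
    (Filter.codiscreteWithin_mono (subset_univ _) hcod)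
  refine (hfin.insert 0).subset ?_
  rintro t ⟨ht, hz⟩
  rcases ht.eq_or_lt with rfl | ht'
  · exact Set.mem_insert _ _
  refine Set.mem_insert_of_mem _ ⟨⟨ht, ?_⟩, by simpa using hz⟩
  set x := t ^ α⁻¹ with hx
  have hx0 : 0 < x := by positivity
  have hxt : x ^ α = t := Real.rpow_inv_rpow ht (by linarith)
  have hb := (hC x hx0).2
  rw [hxt, hz, mul_zero, sub_zero, abs_of_pos (by positivity), div_le_iff₀ hG] at hb
  have hxle : x ≤ (C * Real.Gamma (2 - α)) ^ (2 - α)⁻¹ := by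
    have := Real.rpow_le_rpow (by positivity) hb (show 0 ≤ (2 - α)⁻¹ by rw [inv_nonneg]; linarith)
    rwa [Real.rpow_rpow_inv hx0.le (by linarith)] at this
  rw [← hxt, hM]
  exact Real.rpow_le_rpow hx0.le hxle (by linarith)
end

section
/- If 1 < α ≤ 4/3, then E_{α,2}(t) > 0 for every real number t. -/
open Filter Topology

lemma ml_prod_bound (d m : ℝ) (hm : 1 ≤ m) (hd : m ≤ d) (N : ℕ) :
    ∏ j ∈ Finset.range N, (d + j - m) / (d + j) ≤ (d / (d + N)) ^ m := by
  have hd0 : 0 < d := by linarith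
  induction N with
  | zero => simp [hd0.ne']
  | succ N ih =>
    rw [Finset.prod_range_succ]
    have hN : (0:ℝ) ≤ N := Nat.cast_nonneg N
    have h1 : (d + N - m) / (d + N) ≤ ((d + N) / (d + N + 1)) ^ m := by
      have hb := one_add_mul_self_le_rpow_one_add (s := -1 / (d + N + 1)) (p := m)
        (by rw [le_div_iff₀ (by positivity)]; linarith) hm
      have e1 : 1 + -1 / (d + N + 1) = (d + N) / (d + N + 1) := by
        field_simp; ring
      rw [e1] at hb
      refine le_trans ?_ hb
      have e2 : (d + N - m) / (d + N) = 1 - m / (d + N) := by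
        field_simp
      have e3 : 1 + m * (-1 / (d + N + 1)) = 1 - m / (d + N + 1) := by ring
      rw [e2, e3]
      have : m / (d + N + 1) ≤ m / (d + N) := by
        apply div_le_div_of_nonneg_left <;> linarith
      linarith
    have h0 : 0 ≤ (d + N - m) / (d + N) := div_nonneg (by linarith) (by linarith)
    calc _ ≤ (d / (d + N)) ^ m * ((d + N) / (d + N + 1)) ^ m :=
          mul_le_mul ih h1 h0 (by positivity)
      _ = _ := by
        rw [← Real.mul_rpow (by positivity) (by positivity)]
        congr 1
        push_cast
        field_simp
        try ring

/-- entire even series -/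
def MLEnt (a : ℕ → ℝ) : Prop := ∀ x : ℝ, Summable fun k : ℕ => |a k| * (x ^ 2) ^ k

lemma MLEnt.of_le {a b : ℕ → ℝ} (ha : MLEnt a) (h : ∀ k, |b k| ≤ |a k|) : MLEnt b := by
  intro x
  refine Summable.of_nonneg_of_le (fun k => by positivity) (fun k => ?_) (ha x)
  exact mul_le_mul_of_nonneg_right (h k) (by positivity)

lemma MLEnt.summable {a : ℕ → ℝ} (ha : MLEnt a) (x : ℝ) :
    Summable fun k : ℕ => a k * (x ^ 2) ^ k := by
  refine Summable.of_norm ?_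
  refine (ha x).congr fun k => ?_
  rw [Real.norm_eq_abs, abs_mul, abs_of_nonneg (by positivity : (0:ℝ) ≤ (x ^ 2) ^ k)]

lemma MLEnt.continuousOn {a : ℕ → ℝ} (ha : MLEnt a) (x : ℝ) :
    ContinuousOn (fun u : ℝ => ∑' k, a k * ((x * u) ^ 2) ^ k) (Set.Icc 0 1) := by
  refine continuousOn_tsum (u := fun k => |a k| * (x ^ 2) ^ k) (fun k => by fun_prop) (ha x) ?_
  intro k u hu
  rw [Real.norm_eq_abs, abs_mul, abs_of_nonneg (by positivity : (0:ℝ) ≤ ((x * u) ^ 2) ^ k)]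
  refine mul_le_mul_of_nonneg_left (pow_le_pow_left₀ (by positivity) ?_ k) (abs_nonneg _)
  rw [mul_pow]
  have : u ^ 2 ≤ 1 := pow_le_one₀ hu.1 hu.2
  nlinarith [sq_nonneg x]

lemma MLEnt.integral {a : ℕ → ℝ} (ha : MLEnt a) (x : ℝ) (d : ℕ) :
    ∑' k : ℕ, a k / (2 * k + d + 1) * (x ^ 2) ^ k =
      ∫ u in (0:ℝ)..1, (∑' k, a k * ((x * u) ^ 2) ^ k) * u ^ d := by
  have h := intervalIntegral.hasSum_integral_of_dominated_convergence (μ := MeasureTheory.volume)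
    (a := (0:ℝ)) (b := 1)
    (F := fun (k : ℕ) (u : ℝ) => a k * ((x * u) ^ 2) ^ k * u ^ d)
    (f := fun u => (∑' k, a k * ((x * u) ^ 2) ^ k) * u ^ d)
    (fun k _ => |a k| * (x ^ 2) ^ k) (fun k => by
      apply Continuous.aestronglyMeasurable; fun_prop) (fun k => by
      refine Eventually.of_forall fun u hu => ?_
      rw [Set.uIoc_of_le zero_le_one] at hu
      have hu0 := hu.1.le
      rw [Real.norm_eq_abs, abs_mul, abs_mul,
        abs_of_nonneg (by positivity : (0:ℝ) ≤ ((x * u) ^ 2) ^ k),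
        abs_of_nonneg (by positivity : (0:ℝ) ≤ u ^ d)]
      have h1 : u ^ d ≤ 1 := pow_le_one₀ hu0 hu.2
      have h2 : ((x * u) ^ 2) ^ k ≤ (x ^ 2) ^ k := by
        refine pow_le_pow_left₀ (by positivity) ?_ k
        rw [mul_pow]
        have : u ^ 2 ≤ 1 := pow_le_one₀ hu0 hu.2
        nlinarith [sq_nonneg x]
      calc |a k| * ((x * u) ^ 2) ^ k * u ^ d ≤ |a k| * ((x * u) ^ 2) ^ k * 1 := by gcongr
        _ ≤ _ := by rw [mul_one]; gcongr)
    (Eventually.of_forall fun u _ => ha x) (by simp)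
    (Eventually.of_forall fun u _ => ((ha.summable (x * u)).hasSum.mul_right (u ^ d)))
  rw [← h.tsum_eq]
  refine tsum_congr fun k => ?_
  have e : ∀ u : ℝ, a k * ((x * u) ^ 2) ^ k * u ^ d = a k * (x ^ 2) ^ k * u ^ (2 * k + d) := by
    intro u; rw [mul_pow, mul_pow, ← pow_mul u, pow_add]; ring
  simp_rw [e]
  rw [intervalIntegral.integral_const_mul, integral_pow]
  push_cast
  simp
  ring

lemma ml_int_nonneg {a : ℕ → ℝ} (ha : MLEnt a)
    (hp : ∀ x : ℝ, 0 ≤ ∑' k, a k * (x ^ 2) ^ k) (x : ℝ) (d : ℕ) :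
    0 ≤ ∑' k : ℕ, a k / (2 * k + d + 1) * (x ^ 2) ^ k := by
  rw [ha.integral]
  refine intervalIntegral.integral_nonneg zero_le_one fun u hu => ?_
  exact mul_nonneg (hp _) (pow_nonneg hu.1 _)

lemma ml_int_pos {a : ℕ → ℝ} (ha : MLEnt a)
    (hp : ∀ x : ℝ, 0 ≤ ∑' k, a k * (x ^ 2) ^ k) (h0 : 0 < a 0) (x : ℝ) (d : ℕ) :
    0 < ∑' k : ℕ, a k / (2 * k + d + 1) * (x ^ 2) ^ k := by
  rw [ha.integral]
  have hc := ha.continuousOn x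
  refine intervalIntegral.integral_pos zero_lt_one
    (hc.mul (by fun_prop)) (fun u hu => mul_nonneg (hp _) (pow_nonneg hu.1.le _)) ?_
  have hz : ∑' k, a k * ((x * (0:ℝ)) ^ 2) ^ k = a 0 := by
    rw [tsum_eq_single 0]
    · simp
    · intro k hk; simp [hk]
  have h1 : Tendsto (fun u : ℝ => ∑' k, a k * ((x * u) ^ 2) ^ k) (𝓝[>] 0) (𝓝 (a 0)) := by
    have := hc 0 (by simp)
    unfold ContinuousWithinAt at this
    beta_reduce at this
    rw [hz] at this
    refine this.mono_left ?_
    rw [← nhdsWithin_Ioc_eq_nhdsGT (zero_lt_one' ℝ)]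
    exact nhdsWithin_mono _ Set.Ioc_subset_Icc_self
  have h2 := h1.eventually (lt_mem_nhds h0)
  have h3 : ∀ᶠ u : ℝ in 𝓝[>] 0, u ∈ Set.Ioc (0:ℝ) 1 := Ioc_mem_nhdsGT zero_lt_one
  obtain ⟨u, hu1, hu2⟩ := (h2.and h3).exists
  exact ⟨u, Set.Ioc_subset_Icc_self hu2, mul_pos hu1 (pow_pos hu2.1 _)⟩

lemma ml_split {a : ℕ → ℝ} (ha : MLEnt a) (α : ℝ) (x : ℝ) (j : ℕ) :
    ∑' k : ℕ, a k * ((α * k + 2 + j) / (2 * k + 3 + j)) * (x ^ 2) ^ k =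
    α / 2 * ∑' k : ℕ, a k * (x ^ 2) ^ k +
    (2 + j - α / 2 * (3 + j)) * ∑' k : ℕ, a k / (2 * k + (j + 2 : ℕ) + 1) * (x ^ 2) ^ k := by
  have hb : MLEnt fun k : ℕ => a k / (2 * k + (j + 2 : ℕ) + 1) := by
    refine ha.of_le fun k => ?_
    rw [abs_div]
    apply div_le_self (abs_nonneg _)
    have : (0:ℝ) ≤ 2 * k + (j + 2 : ℕ) := by positivity
    rw [abs_of_nonneg (by linarith)]; linarith
  rw [← tsum_mul_left, ← tsum_mul_left,
    ← ((ha.summable x).mul_left _).tsum_add ((hb.summable x).mul_left _)]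
  refine tsum_congr fun k => ?_
  have : (2 * k + 3 + j : ℝ) ≠ 0 := by positivity
  have e : (2 * k + (j + 2 : ℕ) + 1 : ℝ) = 2 * k + 3 + j := by push_cast; ring
  rw [e]
  field_simp
  ring

lemma ml_fac {a : ℕ → ℝ} (ha : MLEnt a) (α : ℝ) (h1 : 1 < α) (h2 : α ≤ 4 / 3) (j : ℕ) :
    MLEnt fun k : ℕ => a k * ((α * k + 2 + j) / (2 * k + 3 + j)) := by
  refine ha.of_le fun k => ?_
  rw [abs_mul]
  have h0 : (0:ℝ) ≤ (α * k + 2 + j) / (2 * k + 3 + j) := by positivity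
  rw [abs_of_nonneg h0]
  apply mul_le_of_le_one_right (abs_nonneg _)
  rw [div_le_one (by positivity)]
  have : (0:ℝ) ≤ k := Nat.cast_nonneg k
  nlinarith

lemma ml_prod_nonneg {a : ℕ → ℝ} (ha : MLEnt a)
    (hp : ∀ x : ℝ, 0 ≤ ∑' k, a k * (x ^ 2) ^ k) (α : ℝ) (h1 : 1 < α) (h2 : α ≤ 4 / 3)
    (S : Finset ℕ) :
    MLEnt (fun k : ℕ => a k * ∏ j ∈ S, ((α * k + 2 + j) / (2 * k + 3 + j))) ∧
    ∀ x : ℝ, 0 ≤ ∑' k : ℕ, a k * (∏ j ∈ S, ((α * k + 2 + j) / (2 * k + 3 + j))) * (x ^ 2) ^ k := by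
  classical
  induction S using Finset.induction_on with
  | empty => simpa using ⟨ha, hp⟩
  | insert j S hj ih =>
    obtain ⟨i1, i2⟩ := ih
    have e : (fun k : ℕ => a k * ∏ j ∈ insert j S, ((α * k + 2 + j) / (2 * k + 3 + j))) =
      fun k : ℕ => (a k * ∏ j ∈ S, ((α * k + 2 + j) / (2 * k + 3 + j))) *
        ((α * k + 2 + j) / (2 * k + 3 + j)) := by
      funext k; rw [Finset.prod_insert hj]; ring
    have e' := fun k => congrFun e k
    simp only [e']
    refine ⟨ml_fac i1 α h1 h2 j, fun x => ?_⟩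
    rw [ml_split i1]
    have hj : (0:ℝ) ≤ j := Nat.cast_nonneg j
    refine add_nonneg (mul_nonneg (by linarith) (i2 x)) (mul_nonneg (by nlinarith) ?_)
    exact ml_int_nonneg i1 i2 x _

/-- base coefficients -/
noncomputable def mlA (k : ℕ) : ℝ := (-1) ^ k / (2 * k + 2).factorial

lemma mlA_abs (k : ℕ) : |mlA k| = 1 / (2 * k + 2).factorial := by
  unfold mlA
  rw [abs_div, abs_pow]; simp

lemma mlA_bound (k : ℕ) : |mlA k| * (2 * k + 3 : ℝ) ^ (k + 1) ≤ 2 * (2 ^ k / k.factorial) := by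
  rw [mlA_abs]
  have h := Nat.factorial_mul_pow_le_factorial (m := k + 1) (n := k + 1)
  have e : k + 1 + (k + 1) = 2 * k + 2 := by ring
  rw [e] at h
  have h' : (((k + 1).factorial : ℝ)) * ((k + 1 : ℝ) + 1) ^ (k + 1) ≤ (2 * k + 2).factorial := by
    exact_mod_cast h
  have hk : (k.factorial : ℝ) ≤ (k + 1).factorial := by
    exact_mod_cast Nat.factorial_le (Nat.le_succ k)
  have hkp : (0:ℝ) < k.factorial := by exact_mod_cast Nat.factorial_pos k
  rw [one_div, inv_mul_eq_div, ← mul_div_assoc, div_le_div_iff₀ (by positivity) hkp]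
  calc (2 * k + 3 : ℝ) ^ (k + 1) * k.factorial
      ≤ (2 * ((k + 1 : ℝ) + 1)) ^ (k + 1) * (k + 1).factorial := by
        gcongr; linarith
    _ = 2 * 2 ^ k * (((k + 1).factorial : ℝ) * ((k + 1 : ℝ) + 1) ^ (k + 1)) := by
        rw [mul_pow]; ring
    _ ≤ _ := by gcongr

lemma mlBound_ent : MLEnt fun k : ℕ => 4 * (2 ^ k / (k.factorial : ℝ)) := by
  intro x
  refine ((Real.summable_pow_div_factorial (2 * x ^ 2)).mul_left 4).congr fun k => ?_
  rw [abs_of_nonneg (by positivity), mul_pow]; ring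

lemma mlA_ent : MLEnt mlA := by
  refine mlBound_ent.of_le fun k => ?_
  have h := mlA_bound k
  have h1 : |mlA k| * 1 ≤ |mlA k| * (2 * k + 3 : ℝ) ^ (k + 1) := by
    gcongr
    apply one_le_pow₀
    have : (0:ℝ) ≤ k := Nat.cast_nonneg k
    linarith
  have h2 : (0:ℝ) ≤ 2 ^ k / k.factorial := by positivity
  rw [abs_of_nonneg (by positivity : (0:ℝ) ≤ 4 * (2 ^ k / k.factorial))]
  linarith

lemma ml_hasSum_congr {f g : ℕ → ℝ} {c : ℝ} (h : HasSum f c) (e : ∀ k, g k = f k) :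
    HasSum g c := by
  rwa [funext e]

lemma mlA_nonneg (x : ℝ) : 0 ≤ ∑' k, mlA k * (x ^ 2) ^ k := by
  rcases eq_or_ne x 0 with rfl | hx
  · rw [tsum_eq_single 0]
    · simp [mlA]
    · intro k hk; simp [hk]
  have h := Real.hasSum_cos x
  have h1 := (hasSum_nat_add_iff' 1).mpr h
  have h2 : HasSum (fun k => mlA k * (x ^ 2) ^ k) ((1 - Real.cos x) / x ^ 2) := by
    have h3 := h1.mul_left (-1 / x ^ 2)
    have hv : -1 / x ^ 2 * (Real.cos x - ∑ i ∈ Finset.range 1,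
        (-1) ^ i * x ^ (2 * i) / ((2 * i).factorial : ℝ)) = (1 - Real.cos x) / x ^ 2 := by
      simp; ring
    rw [hv] at h3
    refine ml_hasSum_congr h3 fun k => ?_
    unfold mlA
    have : 2 * (k + 1) = 2 * k + 2 := by ring
    rw [this]
    field_simp
    ring
  rw [h2.tsum_eq]
  exact div_nonneg (by linarith [Real.cos_le_one x]) (by positivity)

/-- the Gamma ratio approximants -/
noncomputable def mlR (α : ℝ) (N k : ℕ) : ℝ :=
  Real.GammaSeq (2 * k + 3) N / Real.GammaSeq (α * k + 2) N

lemma mlR_eq (α : ℝ) (h1 : 1 < α) (N k : ℕ) (hN : 0 < N) :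
    mlR α N k = (N:ℝ) ^ ((2 - α) * k + 1) *
      ∏ j ∈ Finset.range (N + 1), ((α * k + 2 + j) / (2 * k + 3 + j)) := by
  unfold mlR Real.GammaSeq
  have hN' : (0:ℝ) < N := by exact_mod_cast hN
  have p1 : 0 < ∏ j ∈ Finset.range (N + 1), (2 * k + 3 + j : ℝ) :=
    Finset.prod_pos fun j _ => by positivity
  have p2 : 0 < ∏ j ∈ Finset.range (N + 1), (α * k + 2 + j : ℝ) :=
    Finset.prod_pos fun j _ => by positivity
  have hf : (0:ℝ) < N.factorial := by exact_mod_cast Nat.factorial_pos N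
  have e : (N:ℝ) ^ (2 * k + 3 : ℝ) = (N:ℝ) ^ ((2 - α) * k + 1) * (N:ℝ) ^ (α * k + 2 : ℝ) := by
    rw [← Real.rpow_add hN']; congr 1; ring
  have hp : 0 < (N:ℝ) ^ (α * k + 2 : ℝ) := Real.rpow_pos_of_pos hN' _
  rw [e, Finset.prod_div_distrib]
  field_simp

lemma mlR_nonneg (α : ℝ) (h1 : 1 < α) (N k : ℕ) (hN : 0 < N) : 0 ≤ mlR α N k := by
  rw [mlR_eq α h1 N k hN]
  have : 0 < α := by linarith
  exact mul_nonneg (by positivity) (Finset.prod_nonneg fun j _ => by positivity)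

lemma mlR_le (α : ℝ) (h1 : 1 < α) (h2 : α ≤ 4 / 3) (N k : ℕ) (hN : 0 < N) :
    mlR α N k ≤ (2 * k + 3 : ℝ) ^ (k + 1) := by
  rw [mlR_eq α h1 N k hN]
  have hk : (0:ℝ) ≤ k := Nat.cast_nonneg k
  have hN0 : (0:ℝ) ≤ N := Nat.cast_nonneg N
  set m : ℝ := (2 - α) * k + 1 with hm
  have hm1 : 1 ≤ m := by nlinarith
  have hmk : m ≤ k + 1 := by nlinarith
  have hb := ml_prod_bound (2 * k + 3) m hm1 (by linarith) (N + 1)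
  have e : ∏ j ∈ Finset.range (N + 1), ((α * k + 2 + j) / (2 * k + 3 + j) : ℝ) =
      ∏ j ∈ Finset.range (N + 1), ((2 * k + 3 : ℝ) + j - m) / ((2 * k + 3 : ℝ) + j) := by
    refine Finset.prod_congr rfl fun j _ => ?_
    congr 1; rw [hm]; ring
  rw [e]
  calc _ ≤ (N:ℝ) ^ m * ((2 * k + 3 : ℝ) / (2 * k + 3 + (N + 1 : ℕ))) ^ m := by gcongr
    _ = (N * ((2 * k + 3 : ℝ) / (2 * k + 3 + (N + 1 : ℕ)))) ^ m := by
      rw [Real.mul_rpow hN0 (by positivity)]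
    _ ≤ (2 * k + 3 : ℝ) ^ m := by
      apply Real.rpow_le_rpow (by positivity) _ (by linarith)
      rw [← mul_div_assoc, div_le_iff₀ (by positivity)]
      push_cast
      nlinarith
    _ ≤ (2 * k + 3 : ℝ) ^ ((k + 1 : ℕ) : ℝ) := by
      apply Real.rpow_le_rpow_of_exponent_le (by linarith)
      push_cast; exact hmk
    _ = _ := Real.rpow_natCast _ _

/-- the modified limit coefficients -/
noncomputable def mlB (α : ℝ) (k : ℕ) : ℝ :=
  mlA k * ((2 * k + 4) / (α * k + 3)) * ((2 * k + 2).factorial / Real.Gamma (α * k + 2))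

lemma mlR_tendsto (α : ℝ) (h1 : 1 < α) (k : ℕ) :
    Tendsto (fun N => mlR α N k) atTop
      (𝓝 ((2 * k + 2).factorial / Real.Gamma (α * k + 2))) := by
  have hg : Real.Gamma (α * k + 2) ≠ 0 := (Real.Gamma_pos_of_pos (by positivity)).ne'
  have := (Real.GammaSeq_tendsto_Gamma (2 * k + 3)).div (Real.GammaSeq_tendsto_Gamma (α * k + 2)) hg
  have e : Real.Gamma (2 * k + 3) = (2 * k + 2).factorial := by
    rw [← Real.Gamma_nat_eq_factorial]; congr 1; push_cast; ring
  rw [e] at this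
  exact this

lemma ml_term_bound (α : ℝ) (h1 : 1 < α) (h2 : α ≤ 4 / 3) (N k : ℕ) (hN : 0 < N) :
    |mlA k * ((2 * k + 4) / (α * k + 3)) * mlR α N k| ≤ |4 * (2 ^ k / (k.factorial : ℝ))| := by
  have hk : (0:ℝ) ≤ k := Nat.cast_nonneg k
  have hq : (2 * k + 4) / (α * k + 3) ≤ 2 := by
    rw [div_le_iff₀ (by positivity)]; nlinarith
  have hq0 : 0 ≤ (2 * k + 4) / (α * k + 3) := by positivity
  have hR := mlR_le α h1 h2 N k hN
  have hR0 := mlR_nonneg α h1 N k hN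
  rw [abs_mul, abs_mul, abs_of_nonneg hR0, abs_of_nonneg hq0,
    abs_of_nonneg (by positivity : (0:ℝ) ≤ 4 * (2 ^ k / k.factorial))]
  calc _ ≤ |mlA k| * 2 * (2 * k + 3 : ℝ) ^ (k + 1) := by gcongr
    _ = 2 * (|mlA k| * (2 * k + 3 : ℝ) ^ (k + 1)) := by ring
    _ ≤ 2 * (2 * (2 ^ k / k.factorial)) := by linarith [mlA_bound k]
    _ = _ := by ring

lemma mlB_ent (α : ℝ) (h1 : 1 < α) (h2 : α ≤ 4 / 3) : MLEnt (mlB α) := by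
  refine mlBound_ent.of_le fun k => ?_
  have := ((mlR_tendsto α h1 k).const_mul (mlA k * ((2 * k + 4) / (α * k + 3)))).abs
  refine le_of_tendsto this ?_
  filter_upwards [eventually_gt_atTop 0] with N hN
  exact ml_term_bound α h1 h2 N k hN

lemma mlB_nonneg (α : ℝ) (h1 : 1 < α) (h2 : α ≤ 4 / 3) (x : ℝ) :
    0 ≤ ∑' k, mlB α k * (x ^ 2) ^ k := by
  have ht : Tendsto (fun N : ℕ => ∑' k : ℕ, mlA k * ((2 * k + 4) / (α * k + 3)) * mlR α N k *
      (x ^ 2) ^ k) atTop (𝓝 (∑' k, mlB α k * (x ^ 2) ^ k)) := by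
    refine tendsto_tsum_of_dominated_convergence (mlBound_ent x) (fun k => ?_) ?_
    · exact ((mlR_tendsto α h1 k).const_mul _).mul_const _
    · filter_upwards [eventually_gt_atTop 0] with N hN k
      rw [Real.norm_eq_abs, abs_mul, abs_of_nonneg (by positivity : (0:ℝ) ≤ (x ^ 2) ^ k)]
      gcongr ?_ * _
      exact ml_term_bound α h1 h2 N k hN
  refine ge_of_tendsto ht ?_
  filter_upwards [eventually_gt_atTop 0] with N hN
  have hN' : (0:ℝ) < N := by exact_mod_cast hN
  obtain ⟨-, h⟩ := ml_prod_nonneg mlA_ent mlA_nonneg α h1 h2 ((Finset.range (N + 1)).erase 1)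
  have h := mul_nonneg hN'.le (h ((N:ℝ) ^ ((2 - α) / 2) * x))
  rw [← tsum_mul_left] at h
  convert h using 1
  refine tsum_congr fun k => ?_
  rw [mlR_eq α h1 N k hN, ← Finset.mul_prod_erase (Finset.range (N + 1)) _
    (Finset.mem_range.mpr (by omega : 1 < N + 1))]
  have e : (((N:ℝ) ^ ((2 - α) / 2) * x) ^ 2) ^ k = (N:ℝ) ^ ((2 - α) * k) * (x ^ 2) ^ k := by
    rw [mul_pow, mul_pow, ← pow_mul, ← Real.rpow_natCast, ← Real.rpow_mul hN'.le]
    congr 2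
    push_cast; ring
  rw [e, Real.rpow_add hN', Real.rpow_one]
  have hα : 0 < α := by linarith
  have q1 : (α * k + 3 : ℝ) ≠ 0 := by positivity
  have q2 : (2 * k + 4 : ℝ) ≠ 0 := by positivity
  have q : ((2 * k + 4) / (α * k + 3)) * ((α * k + 2 + (1:ℕ)) / (2 * k + 3 + (1:ℕ))) = (1:ℝ) := by
    have : (α * k + 2 + (1:ℕ) : ℝ) = α * k + 3 := by push_cast; ring
    rw [this]
    have : (2 * k + 3 + (1:ℕ) : ℝ) = 2 * k + 4 := by push_cast; ring
    rw [this]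
    field_simp
  linear_combination (mlA k * (N:ℝ) ^ ((2 - α) * k) * N * (x ^ 2) ^ k *
    ∏ j ∈ (Finset.range (N + 1)).erase 1, ((α * k + 2 + j) / (2 * k + 3 + j))) * q

lemma mlB_mul (α : ℝ) (h1 : 1 < α) (k : ℕ) :
    mlB α k * ((α * k + 2 + (1:ℕ)) / (2 * k + 3 + (1:ℕ))) = (-1) ^ k / Real.Gamma (α * k + 2) := by
  have hα : 0 < α := by linarith
  have q1 : (α * k + 3 : ℝ) ≠ 0 := by positivity
  have q2 : (2 * k + 4 : ℝ) ≠ 0 := by positivity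
  have hg : Real.Gamma (α * k + 2) ≠ 0 := (Real.Gamma_pos_of_pos (by positivity)).ne'
  have : (α * k + 2 + (1:ℕ) : ℝ) = α * k + 3 := by push_cast; ring
  rw [this]
  have : (2 * k + 3 + (1:ℕ) : ℝ) = 2 * k + 4 := by push_cast; ring
  rw [this]
  unfold mlB mlA
  have hf : ((2 * k + 2).factorial : ℝ) ≠ 0 := by exact_mod_cast Nat.factorial_ne_zero _
  field_simp

/-- if `1 < α ≤ 4/3`, then `E_{α,2}(t) > 0` for every real `t`. -/
theorem mittagLeffler_pos (α : ℝ) (hα1 : 1 < α) (hα2 : α ≤ 4 / 3) (t : ℝ) :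
    0 < mittagLeffler α 2 t := by
  unfold mittagLeffler
  have hα : 0 < α := by linarith
  have hB := mlB_ent α hα1 hα2
  have hg : ∀ k : ℕ, 0 < Real.Gamma (α * k + 2) := fun k => Real.Gamma_pos_of_pos (by positivity)
  rcases le_or_gt 0 t with ht | ht
  · have hs : Summable fun k : ℕ => t ^ k / Real.Gamma (α * k + 2) := by
      refine (ml_fac hB α hα1 hα2 1 (Real.sqrt t)).congr fun k => ?_
      beta_reduce
      rw [mlB_mul α hα1, Real.sq_sqrt ht, abs_div, abs_of_pos (hg k), abs_pow]
      simp; ring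
    refine hs.tsum_pos (fun k => div_nonneg (pow_nonneg ht k) (hg k).le) 0 ?_
    have := hg 0
    simp only [pow_zero]
    positivity
  · have e : ∀ k : ℕ, t ^ k / Real.Gamma (α * k + 2) =
        mlB α k * ((α * k + 2 + (1:ℕ)) / (2 * k + 3 + (1:ℕ))) * (Real.sqrt (-t) ^ 2) ^ k := by
      intro k
      rw [mlB_mul α hα1, Real.sq_sqrt (by linarith), div_mul_eq_mul_div, ← mul_pow]
      congr 2; ring
    simp_rw [e]
    rw [ml_split hB]
    have hn := mlB_nonneg α hα1 hα2
    refine add_pos_of_nonneg_of_pos (mul_nonneg (by linarith) (hn _)) (mul_pos ?_ ?_)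
    · push_cast; linarith
    · refine ml_int_pos hB hn ?_ _ _
      unfold mlB mlA
      have := hg 0
      positivity
end
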